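/- arXiv:2104.11987 — 9 statements merged into one kernel-verified Lean document; each statement's English description precedes it below -/
import Mathlib

section
/- Let H be a real Hilbert space and let f : H → ℝ be a continuously differentiable function that is μ-strongly convex for some μ > 0. Let x : [t₀, ∞) → H be a twice differentiable function satisfying, for all t ≥ t₀, the heavy ball equation ẍ(t) + 2√μ ẋ(t) + ∇f(x(t)) = 0. Then f(x(t)) − min f = O(e^{−√μ t}) as t → ∞, i.e. there exist C > 0 and T ≥ t₀ such that f(x(t)) − min f ≤ C e^{−√μ t} for all t ≥ T. -/
open Filter Set

/-- A function with `f - (μ / 2) ‖·‖²` convex lies above its tangent paraboloids of curvature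
`μ`. -/
theorem ConvexOn.add_inner_add_sq_le_of_hasGradientAt
    {H : Type*} [NormedAddCommGroup H] [InnerProductSpace ℝ H] [CompleteSpace H]
    {f : H → ℝ} {μ : ℝ} (hsc : ConvexOn ℝ Set.univ (fun y => f y - μ / 2 * ‖y‖ ^ 2))
    {a g : H} (hg : HasGradientAt f g a) (b : H) :
    f a + inner ℝ g (b - a) + μ / 2 * ‖b - a‖ ^ 2 ≤ f b := by
  have hline : HasDerivAt (fun s : ℝ => a + s • (b - a)) (b - a) 0 := by
    simpa using ((hasDerivAt_id (0 : ℝ)).smul_const (b - a)).const_add a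
  have hg' : HasFDerivAt f (InnerProductSpace.toDual ℝ H g) (a + (0 : ℝ) • (b - a)) := by
    simpa using hg.hasFDerivAt
  have hderiv : HasDerivAt
      (fun s : ℝ => f (a + s • (b - a)) - μ / 2 * ‖a + s • (b - a)‖ ^ 2)
      (inner ℝ g (b - a) - μ / 2 * (2 * inner ℝ a (b - a))) 0 := by
    simpa [Function.comp_def, Pi.sub_def] using
      (hg'.comp_hasDerivAt 0 hline).sub ((hline.norm_sq).const_mul (μ / 2))
  have hconv : ConvexOn ℝ Set.univ
      (fun s : ℝ => f (a + s • (b - a)) - μ / 2 * ‖a + s • (b - a)‖ ^ 2) := by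
    simpa [Function.comp_def, AffineMap.lineMap_apply, add_comm] using
      hsc.comp_affineMap (AffineMap.lineMap a b : ℝ →ᵃ[ℝ] H)
  have hslope := hconv.le_slope_of_hasDerivAt (mem_univ 0) (mem_univ 1) one_pos hderiv
  simp only [slope_def_field, one_smul, zero_smul, add_zero, add_sub_cancel, sub_zero,
    div_one] at hslope
  have hb := norm_add_sq_real a (b - a)
  rw [add_sub_cancel] at hb
  rw [hb] at hslope
  linarith

/-- Grönwall's inequality for a linear differential inequality on a half-line. -/
theorem le_mul_exp_neg_of_hasDerivAt_le {E E' : ℝ → ℝ} {t₀ c : ℝ}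
    (hE : ∀ t, t₀ ≤ t → HasDerivAt E (E' t) t) (hle : ∀ t, t₀ ≤ t → E' t ≤ -(c * E t))
    {t : ℝ} (ht : t₀ ≤ t) :
    E t ≤ E t₀ * Real.exp (c * t₀) * Real.exp (-(c * t)) := by
  have hd : ∀ s, t₀ ≤ s → HasDerivAt (fun r => E r * Real.exp (c * r))
      (E' s * Real.exp (c * s) + E s * (Real.exp (c * s) * c)) s := fun s hs => by
    simpa [Pi.mul_def] using (hE s hs).mul ((hasDerivAt_id s).const_mul c).exp
  have hanti : AntitoneOn (fun r => E r * Real.exp (c * r)) (Ici t₀) := by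
    refine antitoneOn_of_deriv_nonpos (convex_Ici t₀)
      (fun s hs => (hd s hs).continuousAt.continuousWithinAt)
      (fun s hs => (hd s (interior_subset hs)).differentiableAt.differentiableWithinAt)
      fun s hs => ?_
    have hs' : t₀ ≤ s := interior_subset hs
    rw [(hd s hs').deriv]
    nlinarith [mul_le_mul_of_nonneg_right (hle s hs') (Real.exp_pos (c * s)).le]
  have h := hanti self_mem_Ici ht ht
  rw [Real.exp_neg, ← div_eq_mul_inv, le_div_iff₀ (Real.exp_pos _)]
  exact h

/-- Exponential convergence of values for the heavy ball method applied to a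
`μ`-strongly convex `C¹` function (Theorem 1.1). -/
theorem heavy_ball_strongly_convex_exponential_rate
    {H : Type*} [NormedAddCommGroup H] [InnerProductSpace ℝ H] [CompleteSpace H]
    (f : H → ℝ) (f' : H → H) (μ : ℝ) (hμ : 0 < μ)
    (hgrad : ∀ y, HasGradientAt f (f' y) y)
    (hgradcont : Continuous f')
    (hsc : ConvexOn ℝ Set.univ (fun y => f y - μ / 2 * ‖y‖ ^ 2))
    (xbar : H) (hmin : ∀ y, f xbar ≤ f y)
    (t₀ : ℝ) (x x' x'' : ℝ → H)
    (hx1 : ∀ t, t₀ ≤ t → HasDerivAt x (x' t) t)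
    (hx2 : ∀ t, t₀ ≤ t → HasDerivAt x' (x'' t) t)
    (hode : ∀ t, t₀ ≤ t →
      x'' t + (2 * Real.sqrt μ) • x' t + f' (x t) = 0) :
    ∃ C > 0, ∃ T, t₀ ≤ T ∧ ∀ t, T ≤ t →
      f (x t) - f xbar ≤ C * Real.exp (-(Real.sqrt μ * t)) := by
  have hr0 : 0 < √μ := Real.sqrt_pos.2 hμ
  have hrμ : √μ ^ 2 = μ := Real.sq_sqrt hμ.le
  set r := √μ
  let E : ℝ → ℝ := fun t => f (x t) - f xbar + 1 / 2 * ‖r • (x t - xbar) + x' t‖ ^ 2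
  have hE : ∀ t, t₀ ≤ t → HasDerivAt E (inner ℝ (f' (x t)) (x' t) +
      1 / 2 * (2 * inner ℝ (r • (x t - xbar) + x' t) (r • x' t + x'' t))) t := fun t ht => by
    have hv : HasDerivAt (fun s => r • (x s - xbar) + x' s) (r • x' t + x'' t) t :=
      (((hx1 t ht).sub_const xbar).const_smul r).add (hx2 t ht)
    have hf : HasDerivAt (fun s => f (x s)) (inner ℝ (f' (x t)) (x' t)) t := by
      simpa [Function.comp_def] using (hgrad (x t)).hasFDerivAt.comp_hasDerivAt t (hx1 t ht)
    exact (hf.sub_const _).add (hv.norm_sq.const_mul (1 / 2))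
  have hdecay : ∀ t, t₀ ≤ t → inner ℝ (f' (x t)) (x' t) +
      1 / 2 * (2 * inner ℝ (r • (x t - xbar) + x' t) (r • x' t + x'' t)) ≤ -(r * E t) :=
    fun t ht => by
    have hacc : r • x' t + x'' t = -(r • x' t) - f' (x t) := by
      linear_combination (norm := module) hode t ht
    have hconv := hsc.add_inner_add_sq_le_of_hasGradientAt (hgrad (x t)) xbar
    rw [← neg_sub (x t) xbar, norm_neg, inner_neg_right] at hconv
    simp only [E]
    rw [hacc, norm_add_sq_real]
    generalize x t - xbar = d at *
    simp only [inner_add_left, inner_sub_right, inner_neg_right, real_inner_smul_left,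
      real_inner_smul_right, real_inner_self_eq_norm_sq, norm_smul, mul_pow, Real.norm_eq_abs,
      sq_abs, hrμ]
    rw [real_inner_comm (f' (x t)) d, real_inner_comm (f' (x t)) (x' t)] at *
    have h1 := mul_le_mul_of_nonneg_left hconv hr0.le
    have h2 := mul_nonneg hr0.le (sq_nonneg ‖x' t‖)
    linarith
  have hE0 : 0 ≤ E t₀ := add_nonneg (sub_nonneg.2 (hmin _)) (by positivity)
  refine ⟨E t₀ * Real.exp (r * t₀) + 1, by positivity, t₀, le_rfl, fun t ht => ?_⟩
  calc f (x t) - f xbar ≤ E t := le_add_of_nonneg_right (by positivity)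
    _ ≤ E t₀ * Real.exp (r * t₀) * Real.exp (-(r * t)) :=
      le_mul_exp_neg_of_hasDerivAt_le hE hdecay ht
    _ ≤ (E t₀ * Real.exp (r * t₀) + 1) * Real.exp (-(r * t)) := by
      gcongr
      linarith
end

section
/- Under hypotheses (H1)–(H3) and for any δ > 0 and any initial data (x₀, v₀) ∈ H × H, there exists a unique global classical (twice continuously differentiable) solution x : [t₀, ∞) → H of the Cauchy problem ẍ(t) + δ√ε(t) ẋ(t) + ∇f(x(t)) + ε(t) x(t) = 0, x(t₀) = x₀, ẋ(t₀) = v₀. -/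
open Filter Set

/-- Two integral curves on adjacent intervals which agree at the common endpoint concatenate to an
integral curve on the union. -/
theorem IsIntegralCurveOn.concat_Icc {E : Type*} [NormedAddCommGroup E] [NormedSpace ℝ E]
    {F : ℝ → E → E} {α β : ℝ → E} {a b c : ℝ} (hab : a ≤ b) (hbc : b ≤ c)
    (hα : IsIntegralCurveOn α F (Icc a b)) (hβ : IsIntegralCurveOn β F (Icc b c))
    (h : α b = β b) :
    IsIntegralCurveOn (fun t => if t ≤ b then α t else β t) F (Icc a c) := by
  have hleft : ∀ t ∈ Icc a b, (if t ≤ b then α t else β t) = α t := fun t ht => if_pos ht.2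
  have hright : ∀ t ∈ Icc b c, (if t ≤ b then α t else β t) = β t := by
    intro t ht
    rcases ht.1.eq_or_lt with rfl | hlt
    · simp [h]
    · exact if_neg hlt.not_ge
  intro t _
  rw [← Icc_union_Icc_eq_Icc hab hbc]
  refine HasDerivWithinAt.union ?_ ?_
  · by_cases htb : t ∈ Icc a b
    · have := (hα t htb).congr_of_mem hleft htb
      simpa only [hleft t htb] using this
    · exact HasFDerivWithinAt.of_notMem_closure (by rwa [isClosed_Icc.closure_eq])
  · by_cases htb : t ∈ Icc b c
    · have := (hβ t htb).congr_of_mem hright htb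
      simpa only [hright t htb] using this
    · exact HasFDerivWithinAt.of_notMem_closure (by rwa [isClosed_Icc.closure_eq])

section GlobalSolution

variable {E : Type*} [NormedAddCommGroup E] [NormedSpace ℝ E] {F : ℝ → E → E} {t₀ : ℝ}

/-- Integral curves starting from the same point coincide if the vector field is Lipschitz on
bounded sets, locally uniformly in time. -/
theorem IsIntegralCurveOn.eqOn_Icc_of_lipschitzOnWith_closedBall {T : ℝ}
    (hF : ∀ R : NNReal, ∃ K : NNReal, ∀ t ∈ Icc t₀ T,
      LipschitzOnWith K (F t) (Metric.closedBall 0 R))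
    {α β : ℝ → E} (hα : IsIntegralCurveOn α F (Icc t₀ T))
    (hβ : IsIntegralCurveOn β F (Icc t₀ T)) (h : α t₀ = β t₀) :
    EqOn α β (Icc t₀ T) := by
  obtain ⟨A, hA⟩ := isCompact_Icc.exists_bound_of_continuousOn hα.continuousOn
  obtain ⟨B, hB⟩ := isCompact_Icc.exists_bound_of_continuousOn hβ.continuousOn
  obtain ⟨K, hK⟩ := hF (max A B).toNNReal
  have hR : max A B ≤ ((max A B).toNNReal : ℝ) := Real.le_coe_toNNReal _
  have hderiv : ∀ γ : ℝ → E, IsIntegralCurveOn γ F (Icc t₀ T) →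
      ∀ t ∈ Ico t₀ T, HasDerivWithinAt γ (F t (γ t)) (Ici t) t := fun γ hγ t ht =>
    (hγ t (Ico_subset_Icc_self ht)).mono_of_mem_nhdsWithin
      (mem_of_superset (Icc_mem_nhdsGE ht.2) (Icc_subset_Icc_left ht.1))
  refine ODE_solution_unique_of_mem_Icc_right (s := fun _ => Metric.closedBall 0 _)
    (fun t ht => hK t (Ico_subset_Icc_self ht)) hα.continuousOn (hderiv α hα) (fun t ht => ?_)
    hβ.continuousOn (hderiv β hβ) (fun t ht => ?_) h
  · rw [mem_closedBall_zero_iff]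
    exact (hA t (Ico_subset_Icc_self ht)).trans ((le_max_left _ _).trans hR)
  · rw [mem_closedBall_zero_iff]
    exact (hB t (Ico_subset_Icc_self ht)).trans ((le_max_right _ _).trans hR)

/-- On a compact time interval, integral curves of a vector field which is Lipschitz on bounded sets
exist for a duration which depends only on a bound on the initial value. -/
theorem exists_pos_forall_isIntegralCurveOn_Icc [CompleteSpace E] {T : ℝ}
    (hcont : ∀ z, ContinuousOn (F · z) (Icc t₀ T))
    (hF : ∀ R : NNReal, ∃ K : NNReal, ∀ t ∈ Icc t₀ T,
      LipschitzOnWith K (F t) (Metric.closedBall 0 R)) (R : NNReal) :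
    ∃ h > 0, ∀ s s' : ℝ, t₀ ≤ s → s ≤ s' → s' ≤ T → s' ≤ s + h → ∀ z : E, ‖z‖ ≤ R →
      ∃ β : ℝ → E, β s = z ∧ IsIntegralCurveOn β F (Icc s s') := by
  obtain ⟨K, hK⟩ := hF (R + 1)
  obtain ⟨C, hC⟩ := isCompact_Icc.exists_bound_of_continuousOn (hcont 0)
  set L : NNReal := C.toNNReal + K * (R + 1) + 1 with hL
  have hLpos : 0 < (L : ℝ) := by positivity
  refine ⟨1 / L, by positivity, fun s s' hs hss' hs'T hs'h z hz => ?_⟩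
  have hsub : Icc s s' ⊆ Icc t₀ T := Icc_subset_Icc hs hs'T
  have hball : Metric.closedBall z ((1 : NNReal) : ℝ) ⊆
      Metric.closedBall (0 : E) ((R + 1 : NNReal) : ℝ) := by
    refine Metric.closedBall_subset_closedBall' ?_
    rw [dist_zero_right]
    push_cast
    linarith
  have hPL : IsPicardLindelof F (⟨s, left_mem_Icc.2 hss'⟩ : Icc s s') z 1 0 L K := by
    refine ⟨fun t ht => (hK t (hsub ht)).mono hball, fun x _ => (hcont x).mono hsub, ?_, ?_⟩
    · intro t ht x hx
      have hx' := hball hx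
      have h1 := (hK t (hsub ht)).norm_sub_le hx' (Metric.mem_closedBall_self (by positivity))
      rw [mem_closedBall_zero_iff] at hx'
      rw [sub_zero] at h1
      have h2 : (K : ℝ) * ‖x‖ ≤ K * ((R + 1 : NNReal) : ℝ) := by gcongr
      have h3 := norm_le_norm_add_norm_sub' (F t x) (F t 0)
      have h4 := (hC t (hsub ht)).trans (Real.le_coe_toNNReal C)
      rw [hL]
      push_cast at h2 ⊢
      linarith
    · simp only [sub_self, NNReal.coe_one, NNReal.coe_zero, sub_zero]
      rw [max_eq_left (by linarith)]
      calc (L : ℝ) * (s' - s) ≤ L * (1 / L) := by gcongr; linarith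
        _ = 1 := by field_simp
  exact hPL.exists_eq_forall_mem_Icc_hasDerivWithinAt₀

/-- An a priori bound yields an integral curve on the whole compact time interval. -/
theorem exists_isIntegralCurveOn_Icc_of_norm_le [CompleteSpace E] {T : ℝ} (hT : t₀ ≤ T)
    (hcont : ∀ z, ContinuousOn (F · z) (Icc t₀ T))
    (hF : ∀ R : NNReal, ∃ K : NNReal, ∀ t ∈ Icc t₀ T,
      LipschitzOnWith K (F t) (Metric.closedBall 0 R)) (z₀ : E) (R : NNReal)
    (hbound : ∀ τ ∈ Icc t₀ T, ∀ α : ℝ → E, α t₀ = z₀ → IsIntegralCurveOn α F (Icc t₀ τ) →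
      ‖α τ‖ ≤ R) :
    ∃ α : ℝ → E, α t₀ = z₀ ∧ IsIntegralCurveOn α F (Icc t₀ T) := by
  obtain ⟨h, hh, hstep⟩ := exists_pos_forall_isIntegralCurveOn_Icc hcont hF R
  have hz₀ : ‖z₀‖ ≤ R := by
    refine hbound t₀ (left_mem_Icc.2 hT) (fun _ => z₀) rfl ?_
    intro t _
    exact HasFDerivWithinAt.of_subsingleton (by simp)
  have key : ∀ n : ℕ, ∃ α : ℝ → E, α t₀ = z₀ ∧
      IsIntegralCurveOn α F (Icc t₀ (min (t₀ + n * h) T)) := by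
    intro n
    induction n with
    | zero =>
      have := hstep t₀ t₀ le_rfl le_rfl hT (by linarith) z₀ hz₀
      simpa [min_eq_left hT] using this
    | succ n ih =>
      obtain ⟨α, hα₀, hα⟩ := ih
      have hn : t₀ ≤ t₀ + n * h := le_add_of_nonneg_right (by positivity)
      have h0 : t₀ ≤ min (t₀ + n * h) T := le_min hn hT
      have h1 : min (t₀ + n * h) T ≤ min (t₀ + (n + 1 : ℕ) * h) T := by
        gcongr
        simp
      have h2 : min (t₀ + (n + 1 : ℕ) * h) T ≤ min (t₀ + n * h) T + h := by
        rw [← min_add_add_right]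
        refine min_le_min (le_of_eq ?_) (by linarith)
        push_cast
        ring
      obtain ⟨β, hβ₀, hβ⟩ := hstep _ _ h0 h1 (min_le_right _ _) h2 _
        (hbound _ ⟨h0, min_le_right _ _⟩ α hα₀ hα)
      exact ⟨_, by simp [h0, hα₀], hα.concat_Icc h0 h1 hβ hβ₀.symm⟩
  obtain ⟨n, hn⟩ := exists_nat_ge ((T - t₀) / h)
  have hn' : T ≤ t₀ + n * h := by
    rw [div_le_iff₀ hh] at hn
    linarith
  simpa [min_eq_right hn'] using key n

/-- A vector field which is Lipschitz on bounded sets, locally uniformly in time, and whose integral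
curves starting at `z₀` satisfy an a priori bound on every bounded time interval, has a global
integral curve starting at `z₀`. -/
theorem exists_isIntegralCurveOn_Ici_of_norm_le [CompleteSpace E]
    (hcont : ∀ z, ContinuousOn (F · z) (Ici t₀))
    (hF : ∀ (T : ℝ) (R : NNReal), ∃ K : NNReal, ∀ t ∈ Icc t₀ T,
      LipschitzOnWith K (F t) (Metric.closedBall 0 R)) (z₀ : E)
    (hbound : ∀ T, ∃ R : NNReal, ∀ τ ∈ Icc t₀ T, ∀ α : ℝ → E, α t₀ = z₀ →
      IsIntegralCurveOn α F (Icc t₀ τ) → ‖α τ‖ ≤ R) :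
    ∃ α : ℝ → E, α t₀ = z₀ ∧ IsIntegralCurveOn α F (Ici t₀) := by
  have hex : ∀ T : ℝ, t₀ ≤ T → ∃ α : ℝ → E, α t₀ = z₀ ∧ IsIntegralCurveOn α F (Icc t₀ T) := by
    intro T hT
    obtain ⟨R, hR⟩ := hbound T
    exact exists_isIntegralCurveOn_Icc_of_norm_le hT
      (fun z => (hcont z).mono Icc_subset_Ici_self) (hF T) z₀ R hR
  choose! α hα₀ hα using hex
  have hagree : ∀ T T' : ℝ, t₀ ≤ T → T ≤ T' → EqOn (α T) (α T') (Icc t₀ T) := by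
    intro T T' hT hTT'
    refine IsIntegralCurveOn.eqOn_Icc_of_lipschitzOnWith_closedBall (hF T) (hα T hT)
      ((hα T' (hT.trans hTT')).mono (Icc_subset_Icc_right hTT')) ?_
    rw [hα₀ T hT, hα₀ T' (hT.trans hTT')]
  refine ⟨fun t => α t t, hα₀ t₀ le_rfl, fun t ht => ?_⟩
  have ht' : t₀ ≤ t := ht
  have hT : t₀ ≤ t + 1 := by linarith
  have heq : ∀ s ∈ Icc t₀ (t + 1), α s s = α (t + 1) s := fun s hs =>
    hagree s (t + 1) hs.1 hs.2 (right_mem_Icc.2 hs.1)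
  have hmem : t ∈ Icc t₀ (t + 1) := ⟨ht, by linarith⟩
  have hd := (hα (t + 1) hT t hmem).congr_of_mem heq hmem
  rw [← heq t hmem] at hd
  refine hd.mono_of_mem_nhdsWithin ?_
  rw [← Ici_inter_Iic]
  exact inter_mem self_mem_nhdsWithin (mem_nhdsWithin_of_mem_nhds (Iic_mem_nhds (by linarith)))

end GlobalSolution

section InertialGradient

variable {H : Type*} [NormedAddCommGroup H] [InnerProductSpace ℝ H]

/-- The first-order vector field on the phase space `H × H` associated with the inertial gradient
system with Tikhonov regularization `ẍ + δ√ε ẋ + g x + ε x = 0`. -/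
noncomputable def trigsField (g : H → H) (ε : ℝ → ℝ) (δ t : ℝ) (p : H × H) : H × H :=
  (p.2, -((δ * Real.sqrt (ε t)) • p.2 + g p.1 + ε t • p.1))

theorem isIntegralCurveOn_trigsField {g : H → H} {ε : ℝ → ℝ} {δ : ℝ} {s : Set ℝ}
    {y y' y'' : ℝ → H} (hy : ∀ t ∈ s, HasDerivWithinAt y (y' t) s t)
    (hy' : ∀ t ∈ s, HasDerivWithinAt y' (y'' t) s t)
    (heq : ∀ t ∈ s, y'' t + (δ * Real.sqrt (ε t)) • y' t + g (y t) + ε t • y t = 0) :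
    IsIntegralCurveOn (fun t => (y t, y' t)) (trigsField g ε δ) s := by
  intro t ht
  have h : y'' t = -((δ * Real.sqrt (ε t)) • y' t + g (y t) + ε t • y t) := by
    rw [eq_neg_iff_add_eq_zero, ← heq t ht]
    abel
  have h' := hy' t ht
  rw [h] at h'
  exact (hy t ht).prodMk h'

theorem continuousOn_trigsField {g : H → H} {ε : ℝ → ℝ} {δ : ℝ} {s : Set ℝ}
    (hε : ContinuousOn ε s) (p : H × H) : ContinuousOn (fun t => trigsField g ε δ t p) s := by
  unfold trigsField
  fun_prop

theorem exists_lipschitzOnWith_trigsField {g : H → H} {ε : ℝ → ℝ} {δ t₀ : ℝ}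
    (hg : ∀ s : Set H, Bornology.IsBounded s → ∃ L : NNReal, LipschitzOnWith L g s)
    (hε : ∀ t ∈ Ici t₀, 0 < ε t) (hεanti : AntitoneOn ε (Ici t₀)) (hδ : 0 < δ) (R : NNReal) :
    ∃ K : NNReal, ∀ t ∈ Ici t₀,
      LipschitzOnWith K (trigsField g ε δ t) (Metric.closedBall 0 R) := by
  obtain ⟨L, hL⟩ := hg (Metric.closedBall 0 R) Metric.isBounded_closedBall
  have hε₀ := hε t₀ self_mem_Ici
  refine ⟨(1 + δ * Real.sqrt (ε t₀) + L + ε t₀).toNNReal, fun t ht =>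
    LipschitzOnWith.of_dist_le_mul fun p hp q hq => ?_⟩
  rw [Real.coe_toNNReal _ (by positivity), dist_eq_norm, dist_eq_norm]
  have hεt : ε t ≤ ε t₀ := hεanti self_mem_Ici ht ht
  have hεt₀ := hε t ht
  have h1 : ‖p.1 - q.1‖ ≤ ‖p - q‖ := norm_fst_le (p - q)
  have h2 : ‖p.2 - q.2‖ ≤ ‖p - q‖ := norm_snd_le (p - q)
  have hfst : ∀ r ∈ Metric.closedBall (0 : H × H) (R : ℝ), r.1 ∈ Metric.closedBall (0 : H) R := by
    intro r hr
    rw [mem_closedBall_zero_iff] at hr ⊢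
    exact (norm_fst_le r).trans hr
  have h3 : ‖g p.1 - g q.1‖ ≤ L * ‖p - q‖ :=
    (hL.norm_sub_le (hfst p hp) (hfst q hq)).trans (by gcongr)
  have h4 : ‖(δ * Real.sqrt (ε t)) • (p.2 - q.2)‖ ≤ δ * Real.sqrt (ε t₀) * ‖p - q‖ := by
    rw [norm_smul, Real.norm_of_nonneg (by positivity)]
    gcongr
  have h5 : ‖ε t • (p.1 - q.1)‖ ≤ ε t₀ * ‖p - q‖ := by
    rw [norm_smul, Real.norm_of_nonneg hεt₀.le]
    gcongr
  have hsnd : ‖(trigsField g ε δ t p - trigsField g ε δ t q).2‖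
      ≤ (δ * Real.sqrt (ε t₀) + L + ε t₀) * ‖p - q‖ := by
    have : (trigsField g ε δ t p - trigsField g ε δ t q).2 =
        -((δ * Real.sqrt (ε t)) • (p.2 - q.2) + (g p.1 - g q.1) + ε t • (p.1 - q.1)) := by
      simp only [trigsField, Prod.snd_sub, smul_sub]
      abel
    rw [this, norm_neg]
    refine norm_add₃_le.trans ?_
    linarith
  have hnn : 0 ≤ (δ * Real.sqrt (ε t₀) + L + ε t₀) * ‖p - q‖ := by positivity
  refine max_le ?_ ?_
  · refine h2.trans ?_
    linarith
  · refine hsnd.trans ?_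
    linarith [norm_nonneg (p - q)]

/-- The energy `‖ẋ‖² / 2 + f x + ε ‖x‖² / 2` is nonincreasing along the trajectories. -/
theorem antitoneOn_trigs_energy [CompleteSpace H] {f : H → ℝ} {f' : H → H}
    (hgrad : ∀ y, HasGradientAt f (f' y) y) {ε ε' : ℝ → ℝ} {δ t₀ τ : ℝ}
    (hεderiv : ∀ t, t₀ ≤ t → HasDerivAt ε (ε' t) t) (hεanti : AntitoneOn ε (Ici t₀))
    (hδ : 0 < δ) {α : ℝ → H × H} (hα : IsIntegralCurveOn α (trigsField f' ε δ) (Icc t₀ τ)) :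
    AntitoneOn (fun t => 1 / 2 * ‖(α t).2‖ ^ 2 + f (α t).1 + 1 / 2 * (ε t * ‖(α t).1‖ ^ 2))
      (Icc t₀ τ) := by
  have hd : ∀ t ∈ Icc t₀ τ, HasDerivWithinAt
      (fun t => 1 / 2 * ‖(α t).2‖ ^ 2 + f (α t).1 + 1 / 2 * (ε t * ‖(α t).1‖ ^ 2))
      (-(δ * Real.sqrt (ε t) * ‖(α t).2‖ ^ 2) + 1 / 2 * (ε' t * ‖(α t).1‖ ^ 2)) (Icc t₀ τ) t := by
    intro t ht
    have hx : HasDerivWithinAt (fun t => (α t).1) (α t).2 (Icc t₀ τ) t :=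
      (hα t ht).hasFDerivWithinAt.fst.hasDerivWithinAt.congr_deriv (by simp [trigsField])
    have hv : HasDerivWithinAt (fun t => (α t).2)
        (-((δ * Real.sqrt (ε t)) • (α t).2 + f' (α t).1 + ε t • (α t).1)) (Icc t₀ τ) t :=
      (hα t ht).hasFDerivWithinAt.snd.hasDerivWithinAt.congr_deriv (by simp [trigsField])
    have hf : HasDerivWithinAt (fun t => f (α t).1) (inner ℝ (f' (α t).1) (α t).2)
        (Icc t₀ τ) t := by
      exact ((hgrad (α t).1).hasFDerivAt.comp_hasDerivWithinAt t hx).congr_deriv (by simp)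
    have hε := (hεderiv t ht.1).hasDerivWithinAt (s := Icc t₀ τ)
    refine (((hv.norm_sq.const_mul (1 / 2 : ℝ)).add hf).add
      ((hε.mul hx.norm_sq).const_mul (1 / 2 : ℝ))).congr_deriv ?_
    simp only [inner_neg_right, inner_add_right, inner_smul_right, real_inner_self_eq_norm_sq]
    rw [real_inner_comm (f' (α t).1) (α t).2, real_inner_comm (α t).1 (α t).2]
    ring
  refine antitoneOn_of_hasDerivWithinAt_nonpos (convex_Icc t₀ τ)
    (fun t ht => (hd t ht).continuousWithinAt)
    (fun t ht => (hd t (interior_subset ht)).mono interior_subset) fun t ht => ?_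
  have ht₀ : t₀ ≤ t := (interior_subset ht).1
  have hε' : ε' t ≤ 0 := by
    have h := (hεderiv t ht₀).hasDerivWithinAt (s := Ici t₀)
    rw [← h.derivWithin (uniqueDiffOn_Ici t₀ t ht₀)]
    exact hεanti.derivWithin_nonpos
  have h1 : 0 ≤ δ * Real.sqrt (ε t) * ‖(α t).2‖ ^ 2 := by positivity
  have h2 : ε' t * ‖(α t).1‖ ^ 2 ≤ 0 := mul_nonpos_of_nonpos_of_nonneg hε' (by positivity)
  linarith

theorem exists_norm_le_of_isIntegralCurveOn_trigsField [CompleteSpace H] {f : H → ℝ} {f' : H → H}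
    (hgrad : ∀ y, HasGradientAt f (f' y) y) (hbdd : ∃ m, ∀ y, m ≤ f y) {ε ε' : ℝ → ℝ} {δ t₀ : ℝ}
    (hε : ∀ t ∈ Ici t₀, 0 < ε t)
    (hεderiv : ∀ t, t₀ ≤ t → HasDerivAt ε (ε' t) t) (hεanti : AntitoneOn ε (Ici t₀))
    (hδ : 0 < δ) (z₀ : H × H) (T : ℝ) :
    ∃ R : NNReal, ∀ τ ∈ Icc t₀ T, ∀ α : ℝ → H × H, α t₀ = z₀ →
      IsIntegralCurveOn α (trigsField f' ε δ) (Icc t₀ τ) → ‖α τ‖ ≤ R := by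
  obtain ⟨m, hm⟩ := hbdd
  set C : ℝ := 1 / 2 * ‖z₀.2‖ ^ 2 + f z₀.1 + 1 / 2 * (ε t₀ * ‖z₀.1‖ ^ 2) - m with hC
  refine ⟨(max (Real.sqrt (2 * C / ε T)) (Real.sqrt (2 * C))).toNNReal, fun τ hτ α hα₀ hα => ?_⟩
  have hE := antitoneOn_trigs_energy hgrad hεderiv hεanti hδ hα (left_mem_Icc.2 hτ.1)
    (right_mem_Icc.2 hτ.1) hτ.1
  simp only [hα₀] at hE
  have hετ := hε τ hτ.1
  have hεT := hε T (hτ.1.trans hτ.2)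
  have hεle : ε T ≤ ε τ := hεanti hτ.1 (hτ.1.trans hτ.2) hτ.2
  have hmτ := hm (α τ).1
  have hx : ε T * ‖(α τ).1‖ ^ 2 ≤ ε τ * ‖(α τ).1‖ ^ 2 := by gcongr
  have hx0 : 0 ≤ ε T * ‖(α τ).1‖ ^ 2 := by positivity
  refine le_trans ?_ (Real.le_coe_toNNReal _)
  refine max_le_max (Real.le_sqrt_of_sq_le ?_) (Real.le_sqrt_of_sq_le ?_)
  · rw [le_div_iff₀ hεT]
    linarith [sq_nonneg ‖(α τ).2‖]
  · linarith

end InertialGradient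

/-- Existence and uniqueness of a global classical solution of the Cauchy problem
for (TRIGS): `ẍ(t) + δ√ε(t) ẋ(t) + ∇f(x(t)) + ε(t) x(t) = 0`, `x(t₀)=x₀`, `ẋ(t₀)=v₀`
(Theorem 2.1). Uniqueness is understood as equality on `[t₀, ∞)`. -/
theorem trigs_cauchy_problem_existence_uniqueness
    {H : Type*} [NormedAddCommGroup H] [InnerProductSpace ℝ H] [CompleteSpace H]
    (f : H → ℝ) (f' : H → H)
    (hconv : ConvexOn ℝ Set.univ f)
    (hgrad : ∀ y, HasGradientAt f (f' y) y)
    (hlip : ∀ s : Set H, Bornology.IsBounded s → ∃ L : NNReal, LipschitzOnWith L f' s)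
    (hargmin : ∃ z, ∀ y, f z ≤ f y)
    (t₀ : ℝ) (ε ε' : ℝ → ℝ)
    (hεpos : ∀ t, t₀ ≤ t → 0 < ε t)
    (hεderiv : ∀ t, t₀ ≤ t → HasDerivAt ε (ε' t) t)
    (hεcont : ContinuousOn ε' (Set.Ici t₀))
    (hεanti : AntitoneOn ε (Set.Ici t₀))
    (hεlim : Tendsto ε atTop (nhds 0))
    (δ : ℝ) (hδ : 0 < δ)
    (x₀ v₀ : H) :
    ∃ x x' x'' : ℝ → H,
      ((∀ t ∈ Set.Ici t₀, HasDerivWithinAt x (x' t) (Set.Ici t₀) t) ∧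
       (∀ t ∈ Set.Ici t₀, HasDerivWithinAt x' (x'' t) (Set.Ici t₀) t) ∧
       ContinuousOn x'' (Set.Ici t₀) ∧
       x t₀ = x₀ ∧ x' t₀ = v₀ ∧
       (∀ t ∈ Set.Ici t₀,
         x'' t + (δ * Real.sqrt (ε t)) • x' t + f' (x t) + ε t • x t = 0)) ∧
      (∀ y y' y'' : ℝ → H,
        (∀ t ∈ Set.Ici t₀, HasDerivWithinAt y (y' t) (Set.Ici t₀) t) →
        (∀ t ∈ Set.Ici t₀, HasDerivWithinAt y' (y'' t) (Set.Ici t₀) t) →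
        ContinuousOn y'' (Set.Ici t₀) →
        y t₀ = x₀ → y' t₀ = v₀ →
        (∀ t ∈ Set.Ici t₀,
          y'' t + (δ * Real.sqrt (ε t)) • y' t + f' (y t) + ε t • y t = 0) →
        Set.EqOn x y (Set.Ici t₀)) := by
  have hεIci : ∀ t ∈ Ici t₀, 0 < ε t := hεpos
  have hεcts : ContinuousOn ε (Ici t₀) := fun t ht =>
    (hεderiv t ht).continuousAt.continuousWithinAt
  have hF : ∀ (T : ℝ) (R : NNReal), ∃ K : NNReal, ∀ t ∈ Icc t₀ T,
      LipschitzOnWith K (trigsField f' ε δ t) (Metric.closedBall 0 R) := fun T R => by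
    obtain ⟨K, hK⟩ := exists_lipschitzOnWith_trigsField hlip hεIci hεanti hδ R
    exact ⟨K, fun t ht => hK t ht.1⟩
  have hf'cts : Continuous f' := by
    refine continuous_iff_continuousAt.2 fun y => ?_
    obtain ⟨L, hL⟩ := hlip (Metric.ball y 1) Metric.isBounded_ball
    exact hL.continuousOn.continuousAt (Metric.ball_mem_nhds y one_pos)
  obtain ⟨z, hz⟩ := hargmin
  obtain ⟨α, hα₀, hα⟩ := exists_isIntegralCurveOn_Ici_of_norm_le
    (fun p => continuousOn_trigsField hεcts p) hF (x₀, v₀)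
    (exists_norm_le_of_isIntegralCurveOn_trigsField hgrad ⟨f z, hz⟩ hεIci hεderiv hεanti hδ
      (x₀, v₀))
  have hαcts := hα.continuousOn
  refine ⟨fun t => (α t).1, fun t => (α t).2, fun t => (trigsField f' ε δ t (α t)).2,
    ⟨fun t ht =>
        (hα t ht).hasFDerivWithinAt.fst.hasDerivWithinAt.congr_deriv (by simp [trigsField]),
      fun t ht =>
        (hα t ht).hasFDerivWithinAt.snd.hasDerivWithinAt.congr_deriv (by simp [trigsField]),
      ?_, by simp [hα₀], by simp [hα₀], fun t _ => ?_⟩, ?_⟩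
  · unfold trigsField
    fun_prop
  · simp only [trigsField]
    abel
  · intro y y' y'' hy hy' _ hy₀ hy₀' heq t ht
    have h := ((hα.mono Icc_subset_Ici_self).eqOn_Icc_of_lipschitzOnWith_closedBall (hF t)
      ((isIntegralCurveOn_trigsField hy hy' heq).mono Icc_subset_Ici_self)
      (by simp [hα₀, hy₀, hy₀'])) (right_mem_Icc.2 ht)
    exact congrArg Prod.fst h
end

section
/- Assume hypotheses (H1)–(H3), let δ > 0, and suppose ε(·) satisfies condition (CD)_K for some admissible K, with associated time t₁ ≥ t₀. Let x : [t₀, ∞) → H be a twice differentiable solution of ẍ(t) + δ√ε(t) ẋ(t) + ∇f(x(t)) + ε(t) x(t) = 0 on [t₀, ∞). Define μ(t) = −ε̇(t)/(2ε(t)) + (δ − K)√ε(t), 𝔐(t) = exp(∫_{t₁}^t μ(s) ds), and C = (f(x(t₁)) − min f) + (ε(t₁)/2)‖x(t₁)‖² + (1/2)‖K√ε(t₁)(x(t₁) − x*) + ẋ(t₁)‖². Then for all t ≥ t₁: f(x(t)) − min f ≤ (K‖x*‖²/2) · (1/𝔐(t)) · ∫_{t₁}^t ε(s)^{3/2} 𝔐(s)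 ds + C/𝔐(t). -/
open Filter Set intervalIntegral

/-- The primitive of a function continuous on `[a, ∞)` has that function as derivative
on `[a, ∞)`, one-sided at `a`. -/
theorem hasDerivWithinAt_integral_Ici {h : ℝ → ℝ} {a t : ℝ}
    (hh : ContinuousOn h (Ici a)) (ht : a ≤ t) :
    HasDerivWithinAt (fun u => ∫ s in a..u, h s) (h t) (Ici a) t := by
  have hc : Continuous fun s => h (max a s) :=
    hh.comp_continuous (by fun_prop) fun s => le_max_left a s
  have key := (hc.integral_hasStrictDerivAt a t).hasDerivAt.hasDerivWithinAt (s := Ici a)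
  rw [max_eq_right ht] at key
  have heq : ∀ u ∈ Ici a, ∫ s in a..u, h s = ∫ s in a..u, h (max a s) := fun u hu => by
    refine integral_congr fun s hs => ?_
    rw [uIcc_of_le hu] at hs
    simp only [max_eq_right hs.1]
  exact key.congr heq (heq t ht)

/-- Grönwall's inequality for `E' + μ E ≤ b` on `[a, ∞)`, in integrating-factor form. -/
theorem le_of_deriv_add_mul_le {E E' μ b : ℝ → ℝ} {a : ℝ}
    (hμ : ContinuousOn μ (Ici a)) (hb : ContinuousOn b (Ici a))
    (hE : ∀ t, a ≤ t → HasDerivAt E (E' t) t)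
    (hle : ∀ t, a ≤ t → E' t + μ t * E t ≤ b t) {t : ℝ} (ht : a ≤ t) :
    Real.exp (∫ s in a..t, μ s) * E t ≤
      (∫ s in a..t, b s * Real.exp (∫ u in a..s, μ u)) + E a := by
  set M : ℝ → ℝ := fun s => Real.exp (∫ u in a..s, μ u) with hM
  have hMd : ∀ s, a ≤ s → HasDerivWithinAt M (M s * μ s) (Ici a) s := fun s hs =>
    (hasDerivWithinAt_integral_Ici hμ hs).exp
  have hMc : ContinuousOn M (Ici a) := fun s hs => (hMd s hs).continuousWithinAt
  have hG : ∀ s, a ≤ s → HasDerivWithinAt (fun s => M s * E s - ∫ u in a..s, b u * M u)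
      (M s * μ s * E s + M s * E' s - b s * M s) (Ici a) s := fun s hs =>
    ((hMd s hs).mul (hE s hs).hasDerivWithinAt).sub
      (hasDerivWithinAt_integral_Ici (hb.mul hMc) hs)
  have hanti : AntitoneOn (fun s => M s * E s - ∫ u in a..s, b u * M u) (Ici a) := by
    refine antitoneOn_of_hasDerivWithinAt_nonpos (convex_Ici a)
      (fun s hs => (hG s hs).continuousWithinAt)
      (fun s hs => (hG s (interior_subset hs)).mono interior_subset) fun s hs => ?_
    have hMpos : 0 < M s := Real.exp_pos _
    nlinarith [mul_le_mul_of_nonneg_left (hle s (interior_subset hs)) hMpos.le]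
  have h := hanti (mem_Ici.2 le_rfl) (mem_Ici.2 ht) ht
  have hMa : M a = 1 := by simp [hM]
  simp only [integral_same, hMa] at h
  linarith

/-- The gradient inequality for a convex function. -/
theorem ConvexOn.sub_le_inner_gradient {H : Type*} [NormedAddCommGroup H]
    [InnerProductSpace ℝ H] [CompleteSpace H] {f : H → ℝ} {g x : H}
    (hf : ConvexOn ℝ univ f) (hg : HasGradientAt f g x) (z : H) :
    f x - f z ≤ inner ℝ g (x - z) := by
  have hline : ConvexOn ℝ univ (f ∘ AffineMap.lineMap (k := ℝ) x z) := by
    simpa using hf.comp_affineMap (AffineMap.lineMap (k := ℝ) x z)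
  have hd : HasDerivAt (f ∘ AffineMap.lineMap (k := ℝ) x z) (inner ℝ g (z - x)) 0 := by
    have hg' : HasFDerivAt f (InnerProductSpace.toDual ℝ H g)
        (AffineMap.lineMap (k := ℝ) x z 0) := by simpa using hg.hasFDerivAt
    simpa using hg'.comp_hasDerivAt (0 : ℝ) AffineMap.hasDerivAt_lineMap
  have h := hline.le_slope_of_hasDerivAt (mem_univ 0) (mem_univ 1) one_pos hd
  simp only [slope_def_field, Function.comp_apply, AffineMap.lineMap_apply_zero,
    AffineMap.lineMap_apply_one, sub_zero, div_one] at h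
  rw [← neg_sub z x, inner_neg_right]
  linarith

/-- The pointwise differential inequality satisfied by the Lyapunov function of the
Tikhonov-regularised inertial system, where `w = √ε` and `q = -ε' / (2 ε √ε)`. -/
theorem lyapunov_deriv_add_mul_le {H : Type*} [NormedAddCommGroup H] [InnerProductSpace ℝ H]
    {δ K w q F : ℝ} {x x' x'' g z : H} (hw : 0 ≤ w) (hK : 0 ≤ K) (hq : 0 ≤ q)
    (hq1 : q ≤ 2 * K - δ) (hq2 : q ≤ δ - K) (hKδ : K * (δ - K) ≤ 1)
    (hF : 0 ≤ F) (hFg : F ≤ inner ℝ g (x - z))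
    (hode : x'' + (δ * w) • x' + g + (w ^ 2) • x = 0) :
    inner ℝ g x' + (-(2 * q * w ^ 3) / 2 * ‖x‖ ^ 2 + w ^ 2 / 2 * (2 * inner ℝ x x')) +
        1 / 2 * (2 * inner ℝ ((K * w) • (x - z) + x')
          ((K * w) • x' + (K * -(q * w ^ 2)) • (x - z) + x'')) +
        (q * w + (δ - K) * w) *
          (F + w ^ 2 / 2 * ‖x‖ ^ 2 + 1 / 2 * ‖(K * w) • (x - z) + x'‖ ^ 2) ≤
      K * ‖z‖ ^ 2 / 2 * w ^ 3 := by
  obtain ⟨y, rfl⟩ : ∃ y, z = x - y := ⟨x - z, by abel⟩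
  have hx'' : x'' = -((δ * w) • x' + g + (w ^ 2) • x) := by
    rw [eq_neg_iff_add_eq_zero, ← hode]; abel
  rw [sub_sub_cancel] at *
  subst hx''
  rw [norm_sub_sq_real, norm_add_sq_real ((K * w) • y) x']
  simp only [norm_smul, mul_pow, Real.norm_eq_abs, sq_abs, inner_add_left, inner_add_right,
    inner_neg_right, real_inner_smul_left, real_inner_smul_right, real_inner_self_eq_norm_sq]
  rw [real_inner_comm g y, real_inner_comm g x', real_inner_comm y x', real_inner_comm x y,
    real_inner_comm x x']
  have h1 := mul_nonneg (mul_nonneg hK hw) (sub_nonneg.2 hFg)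
  have h2 := mul_nonneg (mul_nonneg hw (sub_nonneg.2 hq1)) hF
  have h3 := mul_nonneg (mul_nonneg (pow_nonneg hw 3)
    (add_nonneg hq (hq.trans hq1))) (sq_nonneg ‖x‖)
  have h4 := mul_nonneg (mul_nonneg (pow_nonneg hw 3)
    (add_nonneg (mul_nonneg (sq_nonneg K) hq) (mul_nonneg hK (sub_nonneg.2 hKδ)))) (sq_nonneg ‖y‖)
  have h5 := mul_nonneg (mul_nonneg hw (sub_nonneg.2 hq2)) (sq_nonneg ‖x'‖)
  linear_combination h1 + h2 + h3 / 2 + h4 / 2 + h5 / 2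

/-- Convergence rate of values for (TRIGS) under the controlled decay condition
(CD)_K (Theorem 2.3). -/
theorem trigs_value_convergence_rate_general
    {H : Type*} [NormedAddCommGroup H] [InnerProductSpace ℝ H] [CompleteSpace H]
    (f : H → ℝ) (f' : H → H)
    (hconv : ConvexOn ℝ Set.univ f)
    (hgrad : ∀ y, HasGradientAt f (f' y) y)
    (hlip : ∀ s : Set H, Bornology.IsBounded s → ∃ L : NNReal, LipschitzOnWith L f' s)
    (xstar : H)
    (hxstar_min : ∀ y, f xstar ≤ f y)
    (hxstar_norm : ∀ y, (∀ z, f y ≤ f z) → ‖xstar‖ ≤ ‖y‖)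
    (t₀ : ℝ) (ε ε' : ℝ → ℝ)
    (hεpos : ∀ t, t₀ ≤ t → 0 < ε t)
    (hεderiv : ∀ t, t₀ ≤ t → HasDerivAt ε (ε' t) t)
    (hεcont : ContinuousOn ε' (Set.Ici t₀))
    (hεanti : AntitoneOn ε (Set.Ici t₀))
    (hεlim : Tendsto ε atTop (nhds 0))
    (δ K t₁ : ℝ) (hδ : 0 < δ)
    (hK1 : δ ≤ 2 → δ / 2 < K ∧ K < δ)
    (hK2 : 2 < δ → (δ + Real.sqrt (δ ^ 2 - 4)) / 2 < K ∧ K < δ)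
    (ht₁ : t₀ ≤ t₁)
    (hCD : ∀ t, t₁ ≤ t →
      (-ε' t) / (2 * ε t * Real.sqrt (ε t)) ≤ min (2 * K - δ) (δ - K))
    (x x' x'' : ℝ → H)
    (hx1 : ∀ t, t₀ ≤ t → HasDerivAt x (x' t) t)
    (hx2 : ∀ t, t₀ ≤ t → HasDerivAt x' (x'' t) t)
    (hode : ∀ t, t₀ ≤ t →
      x'' t + (δ * Real.sqrt (ε t)) • x' t + f' (x t) + ε t • x t = 0) :
    ∀ t, t₁ ≤ t →
      f (x t) - f xstar ≤
        (K * ‖xstar‖ ^ 2 / 2) *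
          (1 / Real.exp (∫ s in t₁..t,
            (-ε' s / (2 * ε s) + (δ - K) * Real.sqrt (ε s)))) *
          (∫ s in t₁..t, (ε s) ^ ((3 : ℝ) / 2) *
            Real.exp (∫ u in t₁..s,
              (-ε' u / (2 * ε u) + (δ - K) * Real.sqrt (ε u)))) +
        ((f (x t₁) - f xstar) + (ε t₁ / 2) * ‖x t₁‖ ^ 2 +
            (1 / 2) * ‖(K * Real.sqrt (ε t₁)) • (x t₁ - xstar) + x' t₁‖ ^ 2) /
          Real.exp (∫ s in t₁..t,
            (-ε' s / (2 * ε s) + (δ - K) * Real.sqrt (ε s))) := by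
  have hεpos' : ∀ t, t₁ ≤ t → 0 < ε t := fun t ht => hεpos t (ht₁.trans ht)
  have hKpos : 0 < K := by
    rcases le_or_gt δ 2 with h | h
    · linarith [(hK1 h).1]
    · linarith [(hK2 h).1, Real.sqrt_nonneg (δ ^ 2 - 4)]
  have hKδ : K * (δ - K) ≤ 1 := by
    rcases le_or_gt δ 2 with h | h
    · nlinarith [sq_nonneg (2 * K - δ)]
    · have hsq := Real.sq_sqrt (show 0 ≤ δ ^ 2 - 4 by nlinarith)
      nlinarith [(hK2 h).1, Real.sqrt_nonneg (δ ^ 2 - 4)]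
  have hε' : ∀ t, t₀ ≤ t → ε' t ≤ 0 := fun t ht =>
    ((hεderiv t ht).hasDerivWithinAt.mono (Ici_subset_Ici.2 ht)).nonpos_of_antitoneOn
      ((uniqueDiffOn_Ici t) t self_mem_Ici).accPt (hεanti.mono (Ici_subset_Ici.2 ht))
  have hεc : ContinuousOn ε (Ici t₁) := fun t ht =>
    (hεderiv t (ht₁.trans ht)).continuousAt.continuousWithinAt
  have hμ : ContinuousOn (fun s => -ε' s / (2 * ε s) + (δ - K) * Real.sqrt (ε s)) (Ici t₁) := by
    refine ContinuousOn.add (ContinuousOn.div (hεcont.mono (Ici_subset_Ici.2 ht₁)).neg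
      (continuousOn_const.mul hεc) fun s hs => ?_) (continuousOn_const.mul hεc.sqrt)
    have := hεpos' s hs
    positivity
  have hb : ContinuousOn (fun s => K * ‖xstar‖ ^ 2 / 2 * ε s ^ ((3 : ℝ) / 2)) (Ici t₁) :=
    continuousOn_const.mul (hεc.rpow_const fun s hs => Or.inl (hεpos' s hs).ne')
  have hE : ∀ t, t₁ ≤ t → HasDerivAt
      (fun t => (f (x t) - f xstar) + ε t / 2 * ‖x t‖ ^ 2 +
        1 / 2 * ‖(K * Real.sqrt (ε t)) • (x t - xstar) + x' t‖ ^ 2)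
      (inner ℝ (f' (x t)) (x' t) +
        (ε' t / 2 * ‖x t‖ ^ 2 + ε t / 2 * (2 * inner ℝ (x t) (x' t))) +
        1 / 2 * (2 * inner ℝ ((K * Real.sqrt (ε t)) • (x t - xstar) + x' t)
          ((K * Real.sqrt (ε t)) • x' t +
            (K * (ε' t / (2 * Real.sqrt (ε t)))) • (x t - xstar) + x'' t))) t := by
    intro t ht
    have h0 := ht₁.trans ht
    have hfx : HasDerivAt (fun t => f (x t)) (inner ℝ (f' (x t)) (x' t)) t := by
      simpa [Function.comp_def] using (hgrad (x t)).hasFDerivAt.comp_hasDerivAt t (hx1 t h0)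
    have hw := ((hεderiv t h0).sqrt (hεpos' t ht).ne').const_mul K
    exact ((hfx.sub_const _).add (((hεderiv t h0).div_const 2).mul (hx1 t h0).norm_sq)).add
      (((hw.smul ((hx1 t h0).sub_const xstar)).add (hx2 t h0)).norm_sq.const_mul (1 / 2))
  intro t ht
  have key := le_of_deriv_add_mul_le hμ hb hE (fun s hs => ?_) ht
  · have hsplit := intervalIntegral.integral_const_mul (a := t₁) (b := t) (μ := MeasureTheory.volume)
      (K * ‖xstar‖ ^ 2 / 2) fun s => (ε s) ^ ((3 : ℝ) / 2) *
        Real.exp (∫ u in t₁..s, (-ε' u / (2 * ε u) + (δ - K) * Real.sqrt (ε u)))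
    simp only [← mul_assoc] at hsplit
    rw [hsplit] at key
    have hM := Real.exp_pos (∫ s in t₁..t, (-ε' s / (2 * ε s) + (δ - K) * Real.sqrt (ε s)))
    rw [mul_one_div, div_mul_eq_mul_div, ← add_div, le_div_iff₀' hM]
    refine (mul_le_mul_of_nonneg_left ?_ hM.le).trans key
    have := (hεpos' t ht).le
    rw [add_assoc]
    exact le_add_of_nonneg_right (by positivity)
  · have hs0 := ht₁.trans hs
    have hpos := hεpos' s hs
    set w := Real.sqrt (ε s) with hw
    have hwpos : 0 < w := Real.sqrt_pos.2 hpos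
    have hw2 : ε s = w ^ 2 := (Real.sq_sqrt hpos.le).symm
    have hw3 : ε s ^ ((3 : ℝ) / 2) = w ^ 3 := by
      rw [hw, Real.sqrt_eq_rpow, ← Real.rpow_natCast, ← Real.rpow_mul hpos.le]
      norm_num
    obtain ⟨q, hq⟩ : ∃ q, q = -ε' s / (2 * ε s * w) := ⟨_, rfl⟩
    have hq0 : 0 ≤ q := hq ▸ div_nonneg (neg_nonneg.2 (hε' s hs0)) (by positivity)
    have hqle : q ≤ min (2 * K - δ) (δ - K) := hq ▸ hCD s hs
    have hε'q : ε' s = -(2 * q * w ^ 3) := by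
      rw [hq, hw2]; field_simp
    have h1 : -ε' s / (2 * ε s) = q * w := by rw [hε'q, hw2]; field_simp
    have h2 : ε' s / (2 * w) = -(q * w ^ 2) := by rw [hε'q]; field_simp
    have hode' := hode s hs0
    simp only [h1, h2, hw3]
    rw [hε'q, hw2]
    rw [← hw, hw2] at hode'
    exact lyapunov_deriv_add_mul_le hwpos.le hKpos.le hq0 (hqle.trans (min_le_left _ _))
      (hqle.trans (min_le_right _ _)) hKδ (sub_nonneg.2 (hxstar_min _))
      (hconv.sub_le_inner_gradient (hgrad _) _) hode'
end

section
/- Assume hypotheses (H1)–(H3), let δ > 0, and suppose ε(·) satisfies condition (CD)_K for some admissible K, with associated time t₁ ≥ t₀. Define μ(t) = −ε̇(t)/(2ε(t)) + (δ − K)√ε(t) and 𝔐(t) = exp(∫_{t₁}^t μ(s) ds). Then 𝔐(t) → +∞ as t → +∞. -/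
open Filter Set intervalIntegral

/-- The integral of `-ε' / (2 ε) + c √ε` with `c ≥ 0` dominates the decrease of `log ε / 2`. -/
theorem half_log_sub_log_le_integral {ε ε' : ℝ → ℝ} {a b c : ℝ} (hab : a ≤ b) (hc : 0 ≤ c)
    (hpos : ∀ t ∈ Icc a b, 0 < ε t) (hderiv : ∀ t ∈ Icc a b, HasDerivAt ε (ε' t) t)
    (hcont : ContinuousOn ε' (Icc a b)) :
    (Real.log (ε a) - Real.log (ε b)) / 2 ≤
      ∫ s in a..b, (-ε' s / (2 * ε s) + c * Real.sqrt (ε s)) := by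
  have hε : ContinuousOn ε (Icc a b) := fun t ht => (hderiv t ht).continuousAt.continuousWithinAt
  have hlog : ContinuousOn (fun s => -ε' s / (2 * ε s)) (Icc a b) :=
    hcont.neg.div (continuousOn_const.mul hε) fun t ht => by have := hpos t ht; positivity
  have hlog_int : IntervalIntegrable (fun s => -ε' s / (2 * ε s)) MeasureTheory.volume a b :=
    hlog.intervalIntegrable_of_Icc hab
  have hsum_int : IntervalIntegrable (fun s => -ε' s / (2 * ε s) + c * Real.sqrt (ε s))
      MeasureTheory.volume a b :=
    (hlog.add (continuousOn_const.mul hε.sqrt)).intervalIntegrable_of_Icc hab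
  calc (Real.log (ε a) - Real.log (ε b)) / 2
      = ∫ s in a..b, -ε' s / (2 * ε s) := by
        rw [integral_eq_sub_of_hasDerivAt (f := fun s => -Real.log (ε s) / 2) _ hlog_int]
        · ring
        · intro t ht
          rw [uIcc_of_le hab] at ht
          have hne := (hpos t ht).ne'
          have hquot : -ε' t / (2 * ε t) = -(ε' t / ε t) / 2 := by field_simp
          exact hquot ▸ ((hderiv t ht).log hne).neg.div_const 2
    _ ≤ _ := integral_mono_on hab hlog_int hsum_int fun t _ => by
        have := Real.sqrt_nonneg (ε t)
        nlinarith

/-- Under condition (CD)_K, the integrating factor `𝔐(t) = exp(∫_{t₁}^t μ(s) ds)`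
tends to `+∞` (Corollary 2.1, first claim). -/
theorem trigs_integrating_factor_tendsto_atTop
    {H : Type*} [NormedAddCommGroup H] [InnerProductSpace ℝ H] [CompleteSpace H]
    (f : H → ℝ) (f' : H → H)
    (hconv : ConvexOn ℝ Set.univ f)
    (hgrad : ∀ y, HasGradientAt f (f' y) y)
    (hlip : ∀ s : Set H, Bornology.IsBounded s → ∃ L : NNReal, LipschitzOnWith L f' s)
    (hargmin : ∃ z, ∀ y, f z ≤ f y)
    (t₀ : ℝ) (ε ε' : ℝ → ℝ)
    (hεpos : ∀ t, t₀ ≤ t → 0 < ε t)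
    (hεderiv : ∀ t, t₀ ≤ t → HasDerivAt ε (ε' t) t)
    (hεcont : ContinuousOn ε' (Set.Ici t₀))
    (hεanti : AntitoneOn ε (Set.Ici t₀))
    (hεlim : Tendsto ε atTop (nhds 0))
    (δ K t₁ : ℝ) (hδ : 0 < δ)
    (hK1 : δ ≤ 2 → δ / 2 < K ∧ K < δ)
    (hK2 : 2 < δ → (δ + Real.sqrt (δ ^ 2 - 4)) / 2 < K ∧ K < δ)
    (ht₁ : t₀ ≤ t₁)
    (hCD : ∀ t, t₁ ≤ t →
      (-ε' t) / (2 * ε t * Real.sqrt (ε t)) ≤ min (2 * K - δ) (δ - K)) :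
    Tendsto (fun t => Real.exp (∫ s in t₁..t,
        (-ε' s / (2 * ε s) + (δ - K) * Real.sqrt (ε s)))) atTop atTop := by
  have hKδ : K < δ := (le_or_gt δ 2).elim (fun h => (hK1 h).2) fun h => (hK2 h).2
  refine Real.tendsto_exp_atTop.comp ?_
  have hεlim' : Tendsto ε atTop (nhdsWithin 0 (Ioi 0)) :=
    tendsto_nhdsWithin_iff.2 ⟨hεlim, (eventually_ge_atTop t₀).mono hεpos⟩
  have hlog : Tendsto (fun t => (Real.log (ε t₁) - Real.log (ε t)) / 2) atTop atTop := by
    simp_rw [sub_eq_add_neg]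
    exact (tendsto_atTop_add_const_left _ _ (tendsto_neg_atBot_atTop.comp
      (Real.tendsto_log_nhdsGT_zero.comp hεlim'))).atTop_div_const two_pos
  refine tendsto_atTop_mono' _ ?_ hlog
  filter_upwards [eventually_ge_atTop t₁] with t ht
  exact half_log_sub_log_le_integral ht (sub_nonneg.2 hKδ.le)
    (fun s hs => hεpos s (ht₁.trans hs.1)) (fun s hs => hεderiv s (ht₁.trans hs.1))
    (hεcont.mono fun s hs => ht₁.trans hs.1)
end

section
/- Assume hypotheses (H1)–(H3), let δ > 0, suppose ε(·) satisfies condition (CD)_K for some admissible K, and suppose moreover that t ↦ ε(t)^{3/2} is integrable on (t₀, ∞). Let x : [t₀, ∞) → H be a twice differentiable solution of ẍ(t) + δ√ε(t) ẋ(t) + ∇f(x(t)) + ε(t) x(t) = 0 on [t₀, ∞). Then f(x(t)) → min f as t → +∞. -/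
open Filter Set MeasureTheory

/-- The gradient inequality for a convex function. -/
lemma ConvexOn.inner_gradient_le {H : Type*} [NormedAddCommGroup H] [InnerProductSpace ℝ H]
    [CompleteSpace H] {f : H → ℝ} (hf : ConvexOn ℝ Set.univ f) {x g : H}
    (hg : HasGradientAt f g x) (y : H) : inner ℝ g (y - x) ≤ f y - f x := by
  have hline : ConvexOn ℝ Set.univ (f ∘ AffineMap.lineMap (k := ℝ) x y) :=
    hf.comp_affineMap _
  have hderiv : HasDerivAt (f ∘ AffineMap.lineMap (k := ℝ) x y) (inner ℝ g (y - x)) 0 := by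
    have h : HasFDerivAt f (InnerProductSpace.toDual ℝ H g)
        (AffineMap.lineMap (k := ℝ) x y (0 : ℝ)) := by
      simpa using hg.hasFDerivAt
    simpa using h.comp_hasDerivAt (0 : ℝ) (AffineMap.hasDerivAt_lineMap (a := x) (b := y))
  simpa [slope] using hline.le_slope_of_hasDerivAt (mem_univ 0) (mem_univ 1) one_pos hderiv

/-- A nonnegative function `E` with `E' ≤ (s' / s) E + C s ^ 3` tends to zero when `s` decreases
to zero at the rate `s' = -r s ^ 2` and `s ^ 3` has a convergent primitive. -/
lemma tendsto_zero_of_deriv_add_mul_le {E E' s r I : ℝ → ℝ} {C T ℓ : ℝ} (hC : 0 ≤ C)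
    (hE : ∀ t, T ≤ t → HasDerivAt E (E' t) t)
    (hs : ∀ t, T ≤ t → HasDerivAt s (-(r t * s t ^ 2)) t)
    (hI : ∀ t, T ≤ t → HasDerivAt I (s t ^ 3) t)
    (hE0 : ∀ t, T ≤ t → 0 ≤ E t) (hs0 : ∀ t, T ≤ t → 0 < s t) (hr : ∀ t, T ≤ t → 0 ≤ r t)
    (hle : ∀ t, T ≤ t → E' t + r t * s t * E t ≤ C * s t ^ 3)
    (hslim : Tendsto s atTop (nhds 0)) (hIlim : Tendsto I atTop (nhds ℓ)) :
    Tendsto E atTop (nhds 0) := by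
  have hImono : MonotoneOn I (Ici T) := by
    refine monotoneOn_of_hasDerivWithinAt_nonneg (f' := fun t => s t ^ 3) (convex_Ici T)
      (fun t ht => (hI t ht).continuousAt.continuousWithinAt) ?_ ?_
    · intro t ht
      exact (hI t (interior_subset ht)).hasDerivWithinAt
    · intro t ht
      have := hs0 t (interior_subset ht)
      positivity
  have key : ∀ a t, T ≤ a → a ≤ t → E t ≤ E a / s a * s t + C * (I t - I a) := by
    intro a t ha hat
    have hanti : AntitoneOn (fun τ => (E τ - C * (I τ - I a)) / s τ) (Ici a) := by
      have hd : ∀ τ, a ≤ τ → HasDerivAt (fun τ => (E τ - C * (I τ - I a)) / s τ)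
          (((E' τ - C * s τ ^ 3) * s τ - (E τ - C * (I τ - I a)) * (-(r τ * s τ ^ 2)))
            / s τ ^ 2) τ := by
        intro τ hτ
        have hTτ := ha.trans hτ
        exact ((hE τ hTτ).sub (((hI τ hTτ).sub_const _).const_mul C)).div (hs τ hTτ)
          (hs0 τ hTτ).ne'
      refine antitoneOn_of_hasDerivWithinAt_nonpos (convex_Ici a)
        (fun τ hτ => (hd τ hτ).continuousAt.continuousWithinAt)
        (fun τ hτ => (hd τ (interior_subset hτ)).hasDerivWithinAt) ?_
      intro τ hτ
      have haτ : a ≤ τ := interior_subset hτ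
      have hTτ := ha.trans haτ
      have hpos := hs0 τ hTτ
      refine div_nonpos_of_nonpos_of_nonneg ?_ (sq_nonneg _)
      have h1 : 0 ≤ s τ * (C * s τ ^ 3 - (E' τ + r τ * s τ * E τ)) :=
        mul_nonneg hpos.le (sub_nonneg.2 (hle τ hTτ))
      have h2 : 0 ≤ C * r τ * s τ ^ 2 * (I τ - I a) :=
        mul_nonneg (mul_nonneg (mul_nonneg hC (hr τ hTτ)) (sq_nonneg _))
          (sub_nonneg.2 (hImono ha hTτ haτ))
      linarith
    have h := hanti self_mem_Ici hat hat
    simp only [sub_self, mul_zero, sub_zero] at h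
    rw [div_le_iff₀ (hs0 t (ha.trans hat))] at h
    linarith
  rw [Metric.tendsto_atTop]
  intro η hη
  have hCI : Tendsto (fun a => C * (ℓ - I a)) atTop (nhds 0) := by
    simpa using ((tendsto_const_nhds (x := ℓ)).sub hIlim).const_mul C
  obtain ⟨a, ha, haT⟩ :=
    ((hCI.eventually_lt_const (half_pos hη)).and (eventually_ge_atTop T)).exists
  have hsa : Tendsto (fun t => E a / s a * s t) atTop (nhds 0) := by
    simpa using hslim.const_mul (E a / s a)
  obtain ⟨N, hN⟩ := eventually_atTop.1
    ((hsa.eventually_lt_const (half_pos hη)).and (eventually_ge_atTop a))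
  refine ⟨N, fun t ht => ?_⟩
  obtain ⟨h1, h2⟩ := hN t ht
  have hTt := haT.trans h2
  have hIt : I t ≤ ℓ := ge_of_tendsto hIlim <| (eventually_ge_atTop t).mono
    fun u hu => hImono hTt (hTt.trans hu) hu
  have h3 := key a t haT h2
  have h4 : C * (I t - I a) ≤ C * (ℓ - I a) := by gcongr
  rw [Real.dist_eq, sub_zero, abs_of_nonneg (hE0 t hTt)]
  linarith

/-- Pointwise decay estimate for the Lyapunov function of the damped inertial system. The vectors
`u`, `g`, `F` stand for the velocity, the gradient and the gap in value, `s` for `√ε` and `-r s ^ 2`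
for its derivative. -/
lemma lyapunov_deriv_le {H : Type*} [NormedAddCommGroup H] [InnerProductSpace ℝ H]
    (x z u g : H) {F s r δ K e : ℝ} (hs : 0 < s) (hr : 0 ≤ r) (hr1 : r ≤ 2 * K - δ)
    (hr2 : r ≤ δ - K) (hK : 0 < K) (hKδ : K * (δ - K) ≤ 1) (hF : 0 ≤ F)
    (hFg : F ≤ inner ℝ g (x - z)) (he : e ≤ 0) :
    inner ℝ g u + (e / 2 * ‖x‖ ^ 2 + s ^ 2 / 2 * (2 * inner ℝ x u))
      + 1 / 2 * (2 * inner ℝ ((K * s) • (x - z) + u)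
        ((K * s) • u + (K * -(r * s ^ 2)) • (x - z) + -((δ * s) • u + g + s ^ 2 • x)))
      + r * s * (F + s ^ 2 / 2 * ‖x‖ ^ 2 + 1 / 2 * ‖(K * s) • (x - z) + u‖ ^ 2)
      ≤ K / 2 * ‖z‖ ^ 2 * s ^ 3 := by
  obtain ⟨w, rfl⟩ : ∃ w, x = w + z := ⟨x - z, by simp⟩
  rw [add_sub_cancel_right] at *
  have hW : 0 ≤ F + s ^ 2 / 2 * ‖w + z‖ ^ 2 := by positivity
  have h1 : 0 ≤ (K * s - (r + (δ - K)) * s) * (F + s ^ 2 / 2 * ‖w + z‖ ^ 2) := by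
    refine mul_nonneg ?_ hW
    nlinarith
  have h2 : 0 ≤ K * s * (inner ℝ g w - F) := mul_nonneg (by positivity) (by linarith)
  have h3 : 0 ≤ -e / 2 * ‖w + z‖ ^ 2 := mul_nonneg (by linarith) (sq_nonneg _)
  have h4 : 0 ≤ s / 2 * (δ - K - r) * ‖u‖ ^ 2 :=
    mul_nonneg (mul_nonneg (by positivity) (by linarith)) (sq_nonneg _)
  have h5 : 0 ≤ K * s ^ 3 / 2 * (1 - K * (δ - K) + K * r) * ‖w‖ ^ 2 :=
    mul_nonneg (mul_nonneg (by positivity)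
      (add_nonneg (by linarith) (mul_nonneg hK.le hr))) (sq_nonneg _)
  have h6 : 0 ≤ (δ - K) * s *
      (F + s ^ 2 / 2 * ‖w + z‖ ^ 2 + 1 / 2 * ‖(K * s) • w + u‖ ^ 2) :=
    mul_nonneg (mul_nonneg (by linarith) hs.le) (by positivity)
  simp only [← real_inner_self_eq_norm_sq, inner_add_left, inner_add_right, inner_smul_left,
    inner_smul_right, inner_neg_right, RCLike.conj_to_real, real_inner_comm w z,
    real_inner_comm w u, real_inner_comm z u, real_inner_comm u g, real_inner_comm w g] at *
  linarith

/-- Under condition (CD)_K and integrability of `ε^{3/2}`, the values converge to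
the minimum value of `f` along any (TRIGS) trajectory (Corollary 2.1, second claim). -/
theorem trigs_values_tendsto_min
    {H : Type*} [NormedAddCommGroup H] [InnerProductSpace ℝ H] [CompleteSpace H]
    (f : H → ℝ) (f' : H → H)
    (hconv : ConvexOn ℝ Set.univ f)
    (hgrad : ∀ y, HasGradientAt f (f' y) y)
    (hlip : ∀ s : Set H, Bornology.IsBounded s → ∃ L : NNReal, LipschitzOnWith L f' s)
    (xbar : H) (hmin : ∀ y, f xbar ≤ f y)
    (t₀ : ℝ) (ε ε' : ℝ → ℝ)
    (hεpos : ∀ t, t₀ ≤ t → 0 < ε t)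
    (hεderiv : ∀ t, t₀ ≤ t → HasDerivAt ε (ε' t) t)
    (hεcont : ContinuousOn ε' (Set.Ici t₀))
    (hεanti : AntitoneOn ε (Set.Ici t₀))
    (hεlim : Tendsto ε atTop (nhds 0))
    (δ K t₁ : ℝ) (hδ : 0 < δ)
    (hK1 : δ ≤ 2 → δ / 2 < K ∧ K < δ)
    (hK2 : 2 < δ → (δ + Real.sqrt (δ ^ 2 - 4)) / 2 < K ∧ K < δ)
    (ht₁ : t₀ ≤ t₁)
    (hCD : ∀ t, t₁ ≤ t →
      (-ε' t) / (2 * ε t * Real.sqrt (ε t)) ≤ min (2 * K - δ) (δ - K))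
    (hint : IntegrableOn (fun t => (ε t) ^ ((3 : ℝ) / 2)) (Set.Ioi t₀))
    (x x' x'' : ℝ → H)
    (hx1 : ∀ t, t₀ ≤ t → HasDerivAt x (x' t) t)
    (hx2 : ∀ t, t₀ ≤ t → HasDerivAt x' (x'' t) t)
    (hode : ∀ t, t₀ ≤ t →
      x'' t + (δ * Real.sqrt (ε t)) • x' t + f' (x t) + ε t • x t = 0) :
    Tendsto (fun t => f (x t)) atTop (nhds (f xbar)) := by
  have hK : 0 < K ∧ K < δ ∧ K * (δ - K) ≤ 1 := by
    rcases le_or_gt δ 2 with h | h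
    · obtain ⟨h1, h2⟩ := hK1 h
      exact ⟨by linarith, h2, by nlinarith [sq_nonneg (2 * K - δ)]⟩
    · obtain ⟨h1, h2⟩ := hK2 h
      have hw := Real.sqrt_nonneg (δ ^ 2 - 4)
      have hw2 := Real.sq_sqrt (show 0 ≤ δ ^ 2 - 4 by nlinarith)
      exact ⟨by linarith, h2, by nlinarith⟩
  obtain ⟨hK0, hKlt, hKδ⟩ := hK
  have hε'nonpos : ∀ t, t₀ ≤ t → ε' t ≤ 0 := by
    intro t ht
    have h : HasDerivWithinAt ε (ε' t) (Ici t₀) t := (hεderiv t ht).hasDerivWithinAt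
    rw [← h.derivWithin (uniqueDiffOn_Ici t₀ t ht)]
    exact hεanti.derivWithin_nonpos
  let s : ℝ → ℝ := fun t => √(ε t)
  let r : ℝ → ℝ := fun t => (-ε' t) / (2 * ε t * √(ε t))
  have hs0 : ∀ t, t₀ ≤ t → 0 < s t := fun t ht => Real.sqrt_pos.2 (hεpos t ht)
  have hsq : ∀ t, t₀ ≤ t → s t ^ 2 = ε t := fun t ht => Real.sq_sqrt (hεpos t ht).le
  have hscube : ∀ t, t₀ ≤ t → ε t ^ ((3 : ℝ) / 2) = s t ^ 3 := by
    intro t ht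
    rw [Real.rpow_div_two_eq_sqrt _ (hεpos t ht).le]
    exact_mod_cast Real.rpow_natCast (√(ε t)) 3
  have hr0 : ∀ t, t₀ ≤ t → 0 ≤ r t := fun t ht =>
    div_nonneg (neg_nonneg.2 (hε'nonpos t ht))
      (mul_nonneg (mul_nonneg zero_le_two (hεpos t ht).le) (Real.sqrt_nonneg _))
  have hs : ∀ t, t₀ ≤ t → HasDerivAt s (-(r t * s t ^ 2)) t := by
    intro t ht
    have hne := (hεpos t ht).ne'
    have hne' := (hs0 t ht).ne'
    convert (hεderiv t ht).sqrt hne using 1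
    rw [hsq t ht]
    simp only [r, s] at hne' ⊢
    field_simp
  have hslim : Tendsto s atTop (nhds 0) := by
    simpa using hεlim.sqrt
  let I : ℝ → ℝ := fun t => ∫ τ in t₀..t, ε τ ^ ((3 : ℝ) / 2)
  have hI : ∀ t, t₀ < t → HasDerivAt I (s t ^ 3) t := by
    intro t ht
    have hcont : ∀ τ ∈ Ioi t₀, ContinuousAt (fun τ => ε τ ^ ((3 : ℝ) / 2)) τ := fun τ hτ =>
      (hεderiv τ (le_of_lt hτ)).continuousAt.rpow_const (Or.inr (by norm_num))
    rw [← hscube t ht.le]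
    refine intervalIntegral.integral_hasDerivAt_right ?_
      (ContinuousAt.stronglyMeasurableAtFilter isOpen_Ioi hcont t ht) (hcont t ht)
    exact (intervalIntegrable_iff_integrableOn_Ioc_of_le ht.le).2
      (hint.mono_set Ioc_subset_Ioi_self)
  have hIlim := intervalIntegral_tendsto_integral_Ioi t₀ hint tendsto_id
  let v : ℝ → H := fun t => (K * s t) • (x t - xbar) + x' t
  let E : ℝ → ℝ := fun t =>
    f (x t) - f xbar + s t ^ 2 / 2 * ‖x t‖ ^ 2 + 1 / 2 * ‖v t‖ ^ 2
  have hE : ∀ t, t₀ ≤ t → HasDerivAt E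
      (inner ℝ (f' (x t)) (x' t)
        + (ε' t / 2 * ‖x t‖ ^ 2 + s t ^ 2 / 2 * (2 * inner ℝ (x t) (x' t)))
        + 1 / 2 * (2 * inner ℝ (v t) ((K * s t) • x' t + (K * -(r t * s t ^ 2)) • (x t - xbar)
          + -((δ * s t) • x' t + f' (x t) + s t ^ 2 • x t)))) t := by
    intro t ht
    have hf : HasDerivAt (fun t => f (x t) - f xbar) (inner ℝ (f' (x t)) (x' t)) t := by
      simpa using ((hgrad (x t)).hasFDerivAt.comp_hasDerivAt t (hx1 t ht)).sub_const (f xbar)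
    have hs2 : HasDerivAt (fun t => s t ^ 2 / 2) (ε' t / 2) t := by
      have h2 : HasDerivAt (fun t => s t ^ 2) (ε' t) t := by
        refine ((hs t ht).pow 2).congr_deriv ?_
        have hne := (hεpos t ht).ne'
        have hne' := (hs0 t ht).ne'
        rw [hsq t ht]
        simp only [r, s] at hne' ⊢
        field_simp
        norm_num
        ring
      exact h2.div_const 2
    have hx'' : x'' t = -((δ * s t) • x' t + f' (x t) + s t ^ 2 • x t) := by
      rw [hsq t ht, eq_neg_iff_add_eq_zero, ← hode t ht]
      simp only [s]
      abel
    have hv : HasDerivAt v ((K * s t) • x' t + (K * -(r t * s t ^ 2)) • (x t - xbar)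
        + x'' t) t :=
      (((hs t ht).const_mul K).smul ((hx1 t ht).sub_const xbar)).add (hx2 t ht)
    rw [hx''] at hv
    exact (hf.add (hs2.mul (hx1 t ht).norm_sq)).add (hv.norm_sq.const_mul (1 / 2))
  have hgap : ∀ t, f (x t) - f xbar ≤ inner ℝ (f' (x t)) (x t - xbar) := by
    intro t
    have h := hconv.inner_gradient_le (hgrad (x t)) xbar
    rw [← neg_sub, inner_neg_right] at h
    linarith
  have hgap0 : ∀ t, 0 ≤ f (x t) - f xbar := fun t => sub_nonneg.2 (hmin (x t))
  have hgapE : ∀ t, f (x t) - f xbar ≤ E t := by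
    intro t
    have h1 : 0 ≤ s t ^ 2 / 2 * ‖x t‖ ^ 2 := by positivity
    have h2 : 0 ≤ 1 / 2 * ‖v t‖ ^ 2 := by positivity
    simp only [E]
    linarith
  have hElim : Tendsto E atTop (nhds 0) := by
    have h₀ : ∀ {t}, t₁ + 1 ≤ t → t₀ ≤ t := fun ht => by linarith
    refine tendsto_zero_of_deriv_add_mul_le (C := K / 2 * ‖xbar‖ ^ 2) (T := t₁ + 1)
      (by positivity) (fun t ht => hE t (h₀ ht)) (fun t ht => hs t (h₀ ht))
      (fun t ht => hI t (by linarith)) (fun t _ => (hgap0 t).trans (hgapE t))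
      (fun t ht => hs0 t (h₀ ht)) (fun t ht => hr0 t (h₀ ht)) ?_ hslim hIlim
    intro t ht
    have hr := le_min_iff.1 (hCD t (by linarith))
    exact lyapunov_deriv_le (x t) xbar (x' t) (f' (x t)) (hs0 t (h₀ ht)) (hr0 t (h₀ ht))
      hr.1 hr.2 hK0 hKδ (hgap0 t) (hgap t) (hε'nonpos t (h₀ ht))
  rw [← tendsto_sub_nhds_zero_iff]
  exact squeeze_zero hgap0 hgapE hElim
end

section
/- Assume hypotheses (H1)–(H3), let δ > 0, and suppose ε(·) satisfies condition (CD)_K for some admissible K, with associated time t₁ ≥ t₀. Let x : [t₀, ∞) → H be a twice differentiable solution of ẍ(t) + δ√ε(t) ẋ(t) + ∇f(x(t)) + ε(t) x(t) = 0 on [t₀, ∞). Define the energy E(t) = (f(x(t)) − min f) + (ε(t)/2)‖x(t)‖² + (1/2)‖K√ε(t)(x(t) − x*) + ẋ(t)‖² and μ(t) = −ε̇(t)/(2ε(t)) + (δ − K)√ε(t). Then for all t ≥ t₁: Ė(t) + μ(t) E(t) ≤ (K‖x*‖²/2) ε(t)^{3/2}. -/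
open Filter Set

/-- First-order characterization of convexity: a convex function lies above its tangents. -/
theorem ConvexOn.inner_gradient_sub_le
    {H : Type*} [NormedAddCommGroup H] [InnerProductSpace ℝ H] [CompleteSpace H]
    {f : H → ℝ} (hf : ConvexOn ℝ Set.univ f) {g y : H} (hg : HasGradientAt f g y) (z : H) :
    inner ℝ g (z - y) ≤ f z - f y := by
  have hline : HasDerivAt (fun r : ℝ => AffineMap.lineMap y z r) (z - y) 0 :=
    AffineMap.hasDerivAt_lineMap
  have hderiv : HasDerivAt (fun r : ℝ => f (AffineMap.lineMap y z r)) (inner ℝ g (z - y)) 0 := by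
    have h := hg.hasFDerivAt
    rw [← AffineMap.lineMap_apply_zero (k := ℝ) y z] at h
    simpa [Function.comp_def] using h.comp_hasDerivAt (0 : ℝ) hline
  have hconv : ConvexOn ℝ Set.univ (fun r : ℝ => f (AffineMap.lineMap y z r)) :=
    hf.comp_affineMap (AffineMap.lineMap y z)
  simpa [slope_def_field] using
    hconv.le_slope_of_hasDerivAt (mem_univ 0) (mem_univ 1) one_pos hderiv

/-- The friction conditions on `K` make the coefficient of `‖x - x*‖²` nonpositive. -/
theorem half_lt_and_mul_sub_le_one {δ K : ℝ} (hδ : 0 < δ)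
    (hK1 : δ ≤ 2 → δ / 2 < K ∧ K < δ)
    (hK2 : 2 < δ → (δ + Real.sqrt (δ ^ 2 - 4)) / 2 < K ∧ K < δ) :
    δ / 2 < K ∧ K * (δ - K) ≤ 1 := by
  rcases le_or_gt δ 2 with h | h
  · exact ⟨(hK1 h).1, by nlinarith [sq_nonneg (K - δ / 2)]⟩
  · have hroot := (hK2 h).1
    have hnonneg := Real.sqrt_nonneg (δ ^ 2 - 4)
    have hsq := Real.sq_sqrt (show 0 ≤ δ ^ 2 - 4 by nlinarith)
    exact ⟨by linarith, by nlinarith⟩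

/-- The pointwise estimate behind the energy inequality, with `s = √ε`, `a = -ε̇/(2ε)`,
position `u`, velocity `v` and gradient `g`. -/
theorem energy_dissipation_le
    {H : Type*} [NormedAddCommGroup H] [InnerProductSpace ℝ H]
    {u v g p : H} {F s a δ K : ℝ} (hs : 0 < s) (ha : 0 ≤ a) (hF : 0 ≤ F)
    (hgF : F ≤ inner ℝ g (u - p)) (hKpos : 0 < K) (hK1 : K * (δ - K) ≤ 1)
    (ha1 : a ≤ (2 * K - δ) * s) (ha2 : a ≤ (δ - K) * s) :
    inner ℝ g v + (-(a * s ^ 2) * ‖u‖ ^ 2 + s ^ 2 * inner ℝ u v) +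
        inner ℝ ((K * s) • (u - p) + v)
          ((-(K * a * s)) • (u - p) + (K * s) • v +
            -((δ * s) • v + g + s ^ 2 • u)) +
      (a + (δ - K) * s) * (F + s ^ 2 / 2 * ‖u‖ ^ 2 +
        1 / 2 * ‖(K * s) • (u - p) + v‖ ^ 2) ≤ K * ‖p‖ ^ 2 / 2 * s ^ 3 := by
  obtain ⟨w, rfl⟩ : ∃ w, u = w + p := ⟨u - p, by simp⟩
  rw [add_sub_cancel_right] at *
  have hp : ‖p‖ ^ 2 = ‖w + p‖ ^ 2 + ‖w‖ ^ 2 - 2 * inner ℝ w (w + p) := by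
    rw [norm_add_sq_real, inner_add_right, real_inner_self_eq_norm_sq]; ring
  generalize w + p = q at *
  have hE : ‖(K * s) • w + v‖ ^ 2 =
      K ^ 2 * s ^ 2 * ‖w‖ ^ 2 + 2 * K * s * inner ℝ w v + ‖v‖ ^ 2 := by
    rw [norm_add_sq_real, norm_smul, mul_pow, Real.norm_eq_abs, sq_abs, real_inner_smul_left]
    ring
  rw [hE, hp]
  simp only [inner_add_left, inner_add_right, inner_neg_right, real_inner_smul_left,
    real_inner_smul_right, real_inner_self_eq_norm_sq]
  rw [real_inner_comm v g, real_inner_comm w v, real_inner_comm v q]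
  rw [real_inner_comm w g] at hgF
  have h1 : 0 ≤ ((δ - K) * s - a) * ‖v‖ ^ 2 := mul_nonneg (by linarith) (sq_nonneg _)
  have h2 : 0 ≤ ((2 * K - δ) * s - a) * F := mul_nonneg (by linarith) hF
  have h3 : 0 ≤ s ^ 2 * (a + (2 * K - δ) * s) * ‖q‖ ^ 2 :=
    mul_nonneg (mul_nonneg (sq_nonneg _) (by linarith)) (sq_nonneg _)
  have h4 : 0 ≤ s ^ 2 * K * (K * a + s * (1 - K * (δ - K))) * ‖w‖ ^ 2 :=
    mul_nonneg (mul_nonneg (by positivity)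
      (add_nonneg (by positivity) (mul_nonneg hs.le (by linarith)))) (sq_nonneg _)
  have h5 := mul_le_mul_of_nonneg_left hgF (mul_pos hKpos hs).le
  nlinarith only [h1, h2, h3, h4, h5]

/-- The key differential inequality `Ė(t) + μ(t) E(t) ≤ (K‖x*‖²/2) ε(t)^{3/2}`
satisfied by the Lyapunov energy of (TRIGS) (inequality (2.14)). -/
theorem trigs_energy_differential_inequality
    {H : Type*} [NormedAddCommGroup H] [InnerProductSpace ℝ H] [CompleteSpace H]
    (f : H → ℝ) (f' : H → H)
    (hconv : ConvexOn ℝ Set.univ f)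
    (hgrad : ∀ y, HasGradientAt f (f' y) y)
    (hlip : ∀ s : Set H, Bornology.IsBounded s → ∃ L : NNReal, LipschitzOnWith L f' s)
    (xstar : H)
    (hxstar_min : ∀ y, f xstar ≤ f y)
    (hxstar_norm : ∀ y, (∀ z, f y ≤ f z) → ‖xstar‖ ≤ ‖y‖)
    (t₀ : ℝ) (ε ε' : ℝ → ℝ)
    (hεpos : ∀ t, t₀ ≤ t → 0 < ε t)
    (hεderiv : ∀ t, t₀ ≤ t → HasDerivAt ε (ε' t) t)
    (hεcont : ContinuousOn ε' (Set.Ici t₀))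
    (hεanti : AntitoneOn ε (Set.Ici t₀))
    (hεlim : Tendsto ε atTop (nhds 0))
    (δ K t₁ : ℝ) (hδ : 0 < δ)
    (hK1 : δ ≤ 2 → δ / 2 < K ∧ K < δ)
    (hK2 : 2 < δ → (δ + Real.sqrt (δ ^ 2 - 4)) / 2 < K ∧ K < δ)
    (ht₁ : t₀ ≤ t₁)
    (hCD : ∀ t, t₁ ≤ t →
      (-ε' t) / (2 * ε t * Real.sqrt (ε t)) ≤ min (2 * K - δ) (δ - K))
    (x x' x'' : ℝ → H)
    (hx1 : ∀ t, t₀ ≤ t → HasDerivAt x (x' t) t)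
    (hx2 : ∀ t, t₀ ≤ t → HasDerivAt x' (x'' t) t)
    (hode : ∀ t, t₀ ≤ t →
      x'' t + (δ * Real.sqrt (ε t)) • x' t + f' (x t) + ε t • x t = 0)
    (E : ℝ → ℝ)
    (hE : E = fun t => (f (x t) - f xstar) + (ε t / 2) * ‖x t‖ ^ 2 +
      (1 / 2) * ‖(K * Real.sqrt (ε t)) • (x t - xstar) + x' t‖ ^ 2) :
    ∀ t, t₁ ≤ t →
      deriv E t + (-ε' t / (2 * ε t) + (δ - K) * Real.sqrt (ε t)) * E t ≤
        (K * ‖xstar‖ ^ 2 / 2) * (ε t) ^ ((3 : ℝ) / 2) := by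
  intro t ht
  have ht₀ := ht₁.trans ht
  have hpos := hεpos t ht₀
  obtain ⟨hKδ, hKroot⟩ := half_lt_and_mul_sub_le_one hδ hK1 hK2
  have hε'nonpos : ε' t ≤ 0 := by
    rw [← (hεderiv t ht₀).hasDerivWithinAt.derivWithin (uniqueDiffOn_Ici t₀ t ht₀)]
    exact hεanti.derivWithin_nonpos
  have hs : 0 < Real.sqrt (ε t) := Real.sqrt_pos.mpr hpos
  have hsqrt := (hεderiv t ht₀).sqrt hpos.ne'
  have hfx : HasDerivAt (fun r => f (x r)) (inner ℝ (f' (x t)) (x' t)) t := by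
    simpa [Function.comp_def] using
      (hgrad (x t)).hasFDerivAt.comp_hasDerivAt t (hx1 t ht₀)
  have hderiv := ((hfx.sub_const (f xstar)).add
    (((hεderiv t ht₀).div_const 2).mul (hx1 t ht₀).norm_sq)).add
    ((((hsqrt.const_mul K).smul ((hx1 t ht₀).sub_const xstar)).add (hx2 t ht₀)).norm_sq.const_mul
      (1 / 2))
  have hx'' : x'' t = -((δ * Real.sqrt (ε t)) • x' t + f' (x t) + ε t • x t) := by
    rw [eq_neg_iff_add_eq_zero, ← hode t ht₀]; abel
  have hEderiv : HasDerivAt E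
      (inner ℝ (f' (x t)) (x' t) + (ε' t / 2 * ‖x t‖ ^ 2 + ε t * inner ℝ (x t) (x' t)) +
        inner ℝ ((K * Real.sqrt (ε t)) • (x t - xstar) + x' t)
          ((K * (ε' t / (2 * Real.sqrt (ε t)))) • (x t - xstar) +
            (K * Real.sqrt (ε t)) • x' t + x'' t)) t := by
    rw [hE]
    refine hderiv.congr_deriv ?_
    simp only [Pi.add_apply, Pi.smul_apply']
    rw [add_comm ((K * (ε' t / (2 * Real.sqrt (ε t)))) • (x t - xstar))]
    ring
  have hεsq : ε t = Real.sqrt (ε t) ^ 2 := (Real.sq_sqrt hpos.le).symm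
  have hrpow : ε t ^ ((3 : ℝ) / 2) = Real.sqrt (ε t) ^ 3 := by
    rw [Real.sqrt_eq_rpow, ← Real.rpow_natCast, ← Real.rpow_mul hpos.le]; norm_num
  rw [hEderiv.deriv, hx'', hrpow, hE]
  beta_reduce
  have hmin := hCD t ht
  set s := Real.sqrt (ε t)
  set a := -ε' t / (2 * ε t) with ha_def
  have ha : 0 ≤ a := div_nonneg (by linarith) (by positivity)
  have has : -ε' t / (2 * ε t * s) = a / s := by rw [ha_def, div_div]
  have hε' : ε' t = -(2 * a * s ^ 2) := by
    rw [ha_def, ← hεsq]; field_simp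
  rw [has, le_min_iff, div_le_iff₀ hs, div_le_iff₀ hs] at hmin
  have hgF : f (x t) - f xstar ≤ inner ℝ (f' (x t)) (x t - xstar) := by
    have h := hconv.inner_gradient_sub_le (hgrad (x t)) xstar
    rw [← neg_sub, inner_neg_right] at h
    linarith
  have hmain := energy_dissipation_le (v := x' t) hs ha (sub_nonneg.mpr (hxstar_min (x t))) hgF
    (by linarith) hKroot hmin.1 hmin.2
  have hs' : K * (ε' t / (2 * s)) = -(K * a * s) := by
    rw [hε']; field_simp
  have hhalf : ε' t / 2 = -(a * s ^ 2) := by rw [hε']; ring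
  rw [hs', hhalf, hεsq]
  exact hmain
end

section
/- Let α > 3 and c > 0, and let t₀ > 0. Let H be a real Hilbert space, f : H → ℝ convex and differentiable with ∇f Lipschitz continuous on bounded sets, and argmin f nonempty. Let x : [t₀, ∞) → H be a twice differentiable solution of ẍ(t) + (α/t) ẋ(t) + ∇f(x(t)) + (c/t²) x(t) = 0 on [t₀, ∞). Then f(x(t)) − min f = O(1/t²) as t → ∞, i.e. there exist C > 0 and T ≥ t₀ such that f(x(t)) − min f ≤ C/t² for all t ≥ T. -/
open Filter Set

/-- Gradient inequality for convex functions. -/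
lemma ConvexOn.inner_gradient_le_sub {H : Type*} [NormedAddCommGroup H] [InnerProductSpace ℝ H]
    [CompleteSpace H] {f : H → ℝ} (hf : ConvexOn ℝ univ f) {g y : H} (hg : HasGradientAt f g y)
    (z : H) : inner ℝ g (z - y) ≤ f z - f y := by
  have hline : ConvexOn ℝ univ (f ∘ AffineMap.lineMap (k := ℝ) y z) := by
    simpa using hf.comp_affineMap (AffineMap.lineMap (k := ℝ) y z)
  have hd : HasDerivAt (f ∘ AffineMap.lineMap (k := ℝ) y z) (inner ℝ g (z - y)) 0 := by
    have h : HasFDerivAt f (InnerProductSpace.toDual ℝ H g) (AffineMap.lineMap (k := ℝ) y z 0) := by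
      simpa using hg.hasFDerivAt
    simpa using h.comp_hasDerivAt (0 : ℝ) AffineMap.hasDerivAt_lineMap
  simpa [slope_def_field] using
    hline.le_slope_of_hasDerivAt (mem_univ 0) (mem_univ 1) zero_lt_one hd

/-- A function satisfying `t E'(t) ≤ K - κ E(t)` on `[t₀, ∞)` is bounded above there. -/
lemma exists_forall_le_of_mul_deriv_le {E E' : ℝ → ℝ} {t₀ κ K : ℝ} (ht₀ : 0 < t₀) (hκ : 0 < κ)
    (hE : ∀ t, t₀ ≤ t → HasDerivAt E (E' t) t)
    (hle : ∀ t, t₀ ≤ t → t * E' t ≤ K - κ * E t) :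
    ∃ C > 0, ∀ t, t₀ ≤ t → E t ≤ C := by
  have hd : ∀ t, t₀ ≤ t → HasDerivAt (fun s ↦ s ^ κ * (E s - K / κ))
      (κ * t ^ (κ - 1) * (E t - K / κ) + t ^ κ * E' t) t := fun t ht ↦
    (Real.hasDerivAt_rpow_const (.inl (ht₀.trans_le ht).ne')).mul ((hE t ht).sub_const _)
  have hanti : AntitoneOn (fun s ↦ s ^ κ * (E s - K / κ)) (Ici t₀) := by
    refine antitoneOn_of_deriv_nonpos (convex_Ici t₀)
      (fun t ht ↦ (hd t ht).continuousAt.continuousWithinAt)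
      (fun t ht ↦ (hd t (interior_subset ht)).differentiableAt.differentiableWithinAt)
      fun t ht ↦ ?_
    replace ht : t₀ ≤ t := interior_subset ht
    have hpos : 0 < t := ht₀.trans_le ht
    rw [(hd t ht).deriv]
    have hpow : t ^ κ = t ^ (κ - 1) * t := by
      rw [← Real.rpow_add_one hpos.ne', sub_add_cancel]
    have heq : κ * t ^ (κ - 1) * (E t - K / κ) + t ^ κ * E' t
        = t ^ (κ - 1) * (t * E' t - (K - κ * E t)) := by
      rw [hpow]
      field_simp
      ring
    rw [heq]
    exact mul_nonpos_of_nonneg_of_nonpos (Real.rpow_nonneg hpos.le _) (sub_nonpos.2 (hle t ht))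
  refine ⟨|K / κ| + |E t₀ - K / κ| + 1, by positivity, fun t ht ↦ ?_⟩
  have h₁ : t ^ κ * (E t - K / κ) ≤ t₀ ^ κ * (E t₀ - K / κ) :=
    hanti self_mem_Ici ht ht
  have h₂ : t₀ ^ κ * (E t₀ - K / κ) ≤ t ^ κ * |E t₀ - K / κ| := by
    have : t₀ ^ κ ≤ t ^ κ := Real.rpow_le_rpow ht₀.le ht hκ.le
    exact (mul_le_mul_of_nonneg_left (le_abs_self _) (Real.rpow_nonneg ht₀.le κ)).trans
      (mul_le_mul_of_nonneg_right this (abs_nonneg _))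
  have h₃ := le_of_mul_le_mul_left (h₁.trans h₂) (Real.rpow_pos_of_pos (ht₀.trans_le ht) κ)
  linarith [le_abs_self (K / κ)]

/-- `O(1/t²)` convergence of values for the system
`ẍ + (α/t) ẋ + ∇f(x) + (c/t²) x = 0` with `α > 3` (Theorem 2.4). -/
theorem trigs_critical_value_rate_alpha_gt_three
    {H : Type*} [NormedAddCommGroup H] [InnerProductSpace ℝ H] [CompleteSpace H]
    (f : H → ℝ) (f' : H → H)
    (hconv : ConvexOn ℝ Set.univ f)
    (hgrad : ∀ y, HasGradientAt f (f' y) y)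
    (hlip : ∀ s : Set H, Bornology.IsBounded s → ∃ L : NNReal, LipschitzOnWith L f' s)
    (xbar : H) (hmin : ∀ y, f xbar ≤ f y)
    (α c t₀ : ℝ) (hα : 3 < α) (hc : 0 < c) (ht₀ : 0 < t₀)
    (x x' x'' : ℝ → H)
    (hx1 : ∀ t, t₀ ≤ t → HasDerivAt x (x' t) t)
    (hx2 : ∀ t, t₀ ≤ t → HasDerivAt x' (x'' t) t)
    (hode : ∀ t, t₀ ≤ t →
      x'' t + (α / t) • x' t + f' (x t) + (c / t ^ 2) • x t = 0) :
    ∃ C > 0, ∃ T, t₀ ≤ T ∧ ∀ t, T ≤ t →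
      f (x t) - f xbar ≤ C / t ^ 2 := by
  obtain ⟨δ, rfl⟩ : ∃ δ, α = 3 + 2 * δ := ⟨(α - 3) / 2, by ring⟩
  have hδ : 0 < δ := by linarith
  set b : ℝ := 2 + δ with hb
  have hb₀ : 0 < b := by linarith
  set κ : ℝ := min δ (c / (2 * b + δ)) with hκ_def
  have hκ : 0 < κ := lt_min hδ (by positivity)
  have hκδ : κ ≤ δ := min_le_left _ _
  have hκc : κ * (2 * b + δ) ≤ c := (le_div_iff₀ (by positivity)).1 (min_le_right _ _)
  let v : ℝ → H := fun t ↦ b • (x t - xbar) + t • x' t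
  let E : ℝ → ℝ := fun t ↦ t ^ 2 * (f (x t) - f xbar) + c / 2 * ‖x t‖ ^ 2 + 1 / 2 * ‖v t‖ ^ 2
    + b * δ / 2 * ‖x t - xbar‖ ^ 2
  let E' : ℝ → ℝ := fun t ↦ 2 * t * (f (x t) - f xbar) + t ^ 2 * inner ℝ (f' (x t)) (x' t)
    + c / 2 * (2 * inner ℝ (x t) (x' t))
    + 1 / 2 * (2 * inner ℝ (v t) (b • x' t + (t • x'' t + (1 : ℝ) • x' t)))
    + b * δ / 2 * (2 * inner ℝ (x t - xbar) (x' t))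
  have hE : ∀ t, t₀ ≤ t → HasDerivAt E (E' t) t := by
    intro t ht
    have hu := (hx1 t ht).sub_const xbar
    have hv : HasDerivAt v (b • x' t + (t • x'' t + (1 : ℝ) • x' t)) t :=
      (hu.const_smul b).add ((hasDerivAt_id t).smul (hx2 t ht))
    have hf : HasDerivAt (fun s ↦ f (x s) - f xbar) (inner ℝ (f' (x t)) (x' t)) t := by
      simpa using ((hgrad (x t)).hasFDerivAt.comp_hasDerivAt t (hx1 t ht)).sub_const (f xbar)
    have hsq : HasDerivAt (fun s : ℝ ↦ s ^ 2) (2 * t) t := by simpa using hasDerivAt_pow 2 t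
    exact (((hsq.mul hf).add ((hx1 t ht).norm_sq.const_mul _)).add
      (hv.norm_sq.const_mul _)).add (hu.norm_sq.const_mul _)
  have hdecay : ∀ t, t₀ ≤ t → t * E' t ≤ b * c / 2 * ‖xbar‖ ^ 2 - κ * E t := by
    intro t ht
    have hpos : 0 < t := ht₀.trans_le ht
    have hF : 0 ≤ f (x t) - f xbar := sub_nonneg.2 (hmin _)
    have hgi : f (x t) - f xbar ≤ inner ℝ (f' (x t)) (x t - xbar) := by
      have := hconv.inner_gradient_le_sub (hgrad (x t)) xbar
      rw [← neg_sub (x t) xbar, inner_neg_right] at this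
      linarith
    have hv' : t • (b • x' t + (t • x'' t + (1 : ℝ) • x' t))
        = -((δ * t) • x' t + t ^ 2 • f' (x t) + c • x t) := by
      have h := congrArg (fun z ↦ t ^ 2 • z) (hode t ht)
      simp only [smul_add, smul_smul, smul_zero] at h
      rw [show t ^ 2 * ((3 + 2 * δ) / t) = (3 + 2 * δ) * t by field_simp,
        show t ^ 2 * (c / t ^ 2) = c by field_simp] at h
      rw [← sub_eq_zero, ← h, hb]
      module
    have hinner : t * inner ℝ (v t) (b • x' t + (t • x'' t + (1 : ℝ) • x' t))
        = inner ℝ (v t) (-((δ * t) • x' t + t ^ 2 • f' (x t) + c • x t)) := by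
      rw [← hv', real_inner_smul_right]
    have hnorm_v : ‖v t‖ ^ 2 ≤ 2 * (b ^ 2 * ‖x t - xbar‖ ^ 2 + t ^ 2 * ‖x' t‖ ^ 2) := by
      have h := parallelogram_law_with_norm ℝ (b • (x t - xbar)) (t • x' t)
      simp only [norm_smul, Real.norm_eq_abs] at h
      have h₁ := sq_abs b
      have h₂ := sq_abs t
      have h₃ : 0 ≤ ‖b • (x t - xbar) - t • x' t‖ ^ 2 := by positivity
      simp only [v]
      nlinarith
    have hpol : inner ℝ (x t) (x t - xbar)
        = (‖x t‖ ^ 2 + ‖x t - xbar‖ ^ 2 - ‖xbar‖ ^ 2) / 2 := by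
      rw [norm_sub_sq_real, inner_sub_right, real_inner_self_eq_norm_sq]
      ring
    have hexp : t * E' t = 2 * t ^ 2 * (f (x t) - f xbar) - δ * t ^ 2 * ‖x' t‖ ^ 2
        - b * t ^ 2 * inner ℝ (f' (x t)) (x t - xbar) - b * c * inner ℝ (x t) (x t - xbar) := by
      have h : t * E' t = 2 * t ^ 2 * (f (x t) - f xbar) + t ^ 3 * inner ℝ (f' (x t)) (x' t)
          + c * t * inner ℝ (x t) (x' t)
          + t * inner ℝ (v t) (b • x' t + (t • x'' t + (1 : ℝ) • x' t))
          + b * δ * t * inner ℝ (x t - xbar) (x' t) := by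
        simp only [E']
        ring
      rw [h, hinner]
      simp only [v, inner_neg_right, inner_add_right, inner_add_left, real_inner_smul_left,
        real_inner_smul_right, real_inner_self_eq_norm_sq]
      rw [real_inner_comm (f' (x t)) (x t - xbar), real_inner_comm (x t) (x t - xbar),
        real_inner_comm (f' (x t)) (x' t), real_inner_comm (x t) (x' t)]
      ring
    have hE_le : κ * E t ≤ δ * t ^ 2 * (f (x t) - f xbar) + b * c / 2 * ‖x t‖ ^ 2
        + δ * t ^ 2 * ‖x' t‖ ^ 2 + b * c / 2 * ‖x t - xbar‖ ^ 2 := by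
      have h₁ : κ * (t ^ 2 * (f (x t) - f xbar)) ≤ δ * (t ^ 2 * (f (x t) - f xbar)) := by gcongr
      have h₂ : κ * (c / 2 * ‖x t‖ ^ 2) ≤ b * (c / 2 * ‖x t‖ ^ 2) := by
        gcongr
        linarith
      have h₃ : κ * (t ^ 2 * ‖x' t‖ ^ 2) ≤ δ * (t ^ 2 * ‖x' t‖ ^ 2) := by gcongr
      have h₄ : κ * (2 * b + δ) * (b / 2 * ‖x t - xbar‖ ^ 2)
          ≤ c * (b / 2 * ‖x t - xbar‖ ^ 2) := by gcongr
      have h₅ := mul_le_mul_of_nonneg_left hnorm_v hκ.le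
      simp only [E]
      linarith
    have hgi' : b * t ^ 2 * (f (x t) - f xbar)
        ≤ b * t ^ 2 * inner ℝ (f' (x t)) (x t - xbar) := by gcongr
    rw [hexp, hpol]
    have hb' : b * t ^ 2 * (f (x t) - f xbar)
        = 2 * t ^ 2 * (f (x t) - f xbar) + δ * t ^ 2 * (f (x t) - f xbar) := by
      rw [hb]
      ring
    linarith
  obtain ⟨C, hC, hbound⟩ := exists_forall_le_of_mul_deriv_le ht₀ hκ hE hdecay
  refine ⟨C, hC, t₀, le_rfl, fun t ht ↦ ?_⟩
  have hpos : 0 < t := ht₀.trans_le ht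
  rw [le_div_iff₀ (by positivity)]
  have hrest : 0 ≤ c / 2 * ‖x t‖ ^ 2 + 1 / 2 * ‖v t‖ ^ 2 + b * δ / 2 * ‖x t - xbar‖ ^ 2 := by
    positivity
  have := hbound t ht
  simp only [E] at this
  linarith
end

section
/- Let 2/3 < r < 2, δ > 0, and t₀ > 0. Let H be a real Hilbert space, f : H → ℝ convex and differentiable with ∇f Lipschitz continuous on bounded sets, and argmin f nonempty. Let x : [t₀, ∞) → H be a twice differentiable solution of ẍ(t) + (δ/t^{r/2}) ẋ(t) + ∇f(x(t)) + (1/t^r) x(t) = 0 on [t₀, ∞). Then f(x(t)) − min f = O(1/t^{3r/2 − 1}) as t → ∞, i.e. there exist C > 0 and T ≥ t₀ such that f(x(t)) − min f ≤ C · t^{−(3r/2 − 1)} for all t ≥ T. -/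
open Filter Set

theorem ConvexOn.sub_le_inner_of_hasGradientAt {H : Type*} [NormedAddCommGroup H]
    [InnerProductSpace ℝ H] [CompleteSpace H] {f : H → ℝ} {g y : H}
    (hf : ConvexOn ℝ Set.univ f) (hg : HasGradientAt f g y) (z : H) :
    f y - f z ≤ inner ℝ (y - z) g := by
  have hline : HasDerivAt (fun s : ℝ => y + s • (z - y)) (z - y) 0 := by
    simpa using ((hasDerivAt_id (0 : ℝ)).smul_const (z - y)).const_add y
  have hg' : HasFDerivAt f (InnerProductSpace.toDual ℝ H g) (y + (0 : ℝ) • (z - y)) := by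
    simpa using hg.hasFDerivAt
  have hd := hg'.comp_hasDerivAt (0 : ℝ) hline
  have hc : ConvexOn ℝ Set.univ (f ∘ fun s : ℝ => y + s • (z - y)) := by
    have h := hf.comp_affineMap (AffineMap.lineMap y z : ℝ →ᵃ[ℝ] H)
    simpa [Function.comp_def, AffineMap.lineMap_apply, add_comm] using h
  have h := hc.le_slope_of_hasDerivAt (mem_univ 0) (mem_univ 1) one_pos hd
  simp only [InnerProductSpace.toDual_apply_apply, slope_def_field, Function.comp_apply, one_smul,
    zero_smul, add_zero, add_sub_cancel, sub_zero, div_one] at h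
  rw [← neg_sub z y, inner_neg_left, real_inner_comm]
  linarith

/-- The Lyapunov function of the Tikhonov regularized inertial system, as a function of the gap in
values `F`, the square root `s` of the regularization parameter, the position `x`, the
displacement `y` from a minimizer and the velocity `v`. -/
noncomputable def tikhonovEnergy {H : Type*} [NormedAddCommGroup H] [InnerProductSpace ℝ H]
    (δ F s : ℝ) (x y v : H) : ℝ :=
  F + s ^ 2 / 2 * ‖x‖ ^ 2 + δ ^ 2 / 4 * s ^ 2 * ‖y‖ ^ 2 + δ / 2 * s * inner ℝ y v + ‖v‖ ^ 2 / 2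

section

variable {H : Type*} [NormedAddCommGroup H] [InnerProductSpace ℝ H]

theorem abs_mul_inner_le {s : ℝ} (hs : 0 ≤ s) (y v : H) :
    |s * inner ℝ y v| ≤ (s ^ 2 * ‖y‖ ^ 2 + ‖v‖ ^ 2) / 2 := by
  rw [abs_mul, abs_of_nonneg hs]
  have h := mul_le_mul_of_nonneg_left (abs_real_inner_le_norm y v) hs
  nlinarith [sq_nonneg (s * ‖y‖ - ‖v‖)]

theorem le_tikhonovEnergy (δ F s : ℝ) (x y v : H) : F ≤ tikhonovEnergy δ F s x y v := by
  have h := norm_add_sq_real ((δ / 2 * s) • y) v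
  rw [norm_smul, inner_smul_left, mul_pow, Real.norm_eq_abs, sq_abs] at h
  simp only [conj_trivial] at h
  unfold tikhonovEnergy
  nlinarith [sq_nonneg ‖(δ / 2 * s) • y + v‖, sq_nonneg (s * ‖x‖), sq_nonneg (δ * s * ‖y‖)]

theorem tikhonovEnergy_le {δ F s : ℝ} (hδ : 0 ≤ δ) (hF : 0 ≤ F) (hs : 0 ≤ s) (x y v : H) :
    tikhonovEnergy δ F s x y v ≤ (1 + δ + δ ^ 2) *
      (F + s ^ 2 / 2 * ‖x‖ ^ 2 + 3 / 4 * ‖v‖ ^ 2 + s ^ 2 * ‖y‖ ^ 2 / 4) := by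
  have h := mul_le_mul_of_nonneg_left (le_of_abs_le (abs_mul_inner_le hs y v)) hδ
  have hX : 0 ≤ s ^ 2 * ‖x‖ ^ 2 := by positivity
  have hY : 0 ≤ s ^ 2 * ‖y‖ ^ 2 := by positivity
  have hV : 0 ≤ ‖v‖ ^ 2 := by positivity
  have hδ2 : 0 ≤ δ + δ ^ 2 := by positivity
  unfold tikhonovEnergy
  nlinarith [mul_nonneg hδ2 hF, mul_nonneg hδ2 hX, mul_nonneg hδ hV, mul_nonneg (sq_nonneg δ) hV]

variable [CompleteSpace H]

theorem hasDerivAt_tikhonovEnergy {f : H → ℝ} {g p : H} {δ t s' : ℝ} {s : ℝ → ℝ}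
    {x x' : ℝ → H} {a : H} (hg : HasGradientAt f g (x t)) (hs : HasDerivAt s s' t)
    (hx : HasDerivAt x (x' t) t) (hx' : HasDerivAt x' a t)
    (hode : a + (δ * s t) • x' t + g + (s t ^ 2) • x t = 0) :
    HasDerivAt (fun τ => tikhonovEnergy δ (f (x τ) - f p) (s τ) (x τ) (x τ - p) (x' τ))
      (s t * s' * ‖x t‖ ^ 2 + δ ^ 2 / 2 * (s t * s') * ‖x t - p‖ ^ 2
        + δ / 2 * s' * inner ℝ (x t - p) (x' t) - δ / 2 * s t * ‖x' t‖ ^ 2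
        - δ / 2 * s t * (inner ℝ (x t - p) g + s t ^ 2 * inner ℝ (x t - p) (x t))) t := by
  have hfx := (hg.hasFDerivAt.comp_hasDerivAt t hx).sub_const (f p)
  have hy := hx.sub_const p
  have hss := hs.fun_pow 2
  have h := (((hfx.fun_add ((hss.div_const 2).fun_mul hx.norm_sq)).fun_add
    ((hss.const_mul (δ ^ 2 / 4)).fun_mul hy.norm_sq)).fun_add
    ((hs.const_mul (δ / 2)).fun_mul (hy.inner ℝ hx'))).fun_add (hx'.norm_sq.div_const 2)
  have ha : a = -((δ * s t) • x' t) - g - (s t ^ 2) • x t := by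
    rw [← sub_eq_zero, ← hode]; abel
  refine h.congr_deriv ?_
  simp only [ha, inner_sub_right, inner_neg_right, inner_smul_right, real_inner_self_eq_norm_sq,
    InnerProductSpace.toDual_apply_apply]
  rw [real_inner_comm (x' t) g, real_inner_comm (x' t) (x t)]
  push_cast
  ring

theorem tikhonovEnergy_deriv_le {f : H → ℝ} {g p x v : H} {δ s s' : ℝ}
    (hf : ConvexOn ℝ Set.univ f) (hg : HasGradientAt f g x) (hp : ∀ z, f p ≤ f z)
    (hδ : 0 < δ) (hs : 0 < s) (hs' : s' ≤ 0) (hss' : -s' ≤ s ^ 2 / 2) :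
    s * s' * ‖x‖ ^ 2 + δ ^ 2 / 2 * (s * s') * ‖x - p‖ ^ 2
        + δ / 2 * s' * inner ℝ (x - p) v - δ / 2 * s * ‖v‖ ^ 2
        - δ / 2 * s * (inner ℝ (x - p) g + s ^ 2 * inner ℝ (x - p) x) ≤
      -(δ / (2 * (1 + δ + δ ^ 2))) * s * tikhonovEnergy δ (f x - f p) s x (x - p) v
        + δ / 4 * s ^ 3 * ‖p‖ ^ 2 := by
  have hgap := hf.sub_le_inner_of_hasGradientAt hg p
  have hE := tikhonovEnergy_le hδ.le (sub_nonneg.2 (hp x)) hs.le x (x - p) v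
  have hK : 0 < 1 + δ + δ ^ 2 := by positivity
  have hE' : δ / (2 * (1 + δ + δ ^ 2)) * s * tikhonovEnergy δ (f x - f p) s x (x - p) v ≤
      δ / 2 * s * (f x - f p + s ^ 2 / 2 * ‖x‖ ^ 2 + 3 / 4 * ‖v‖ ^ 2
        + s ^ 2 * ‖x - p‖ ^ 2 / 4) := by
    refine (mul_le_mul_of_nonneg_left hE (by positivity)).trans_eq ?_
    field_simp
  have hpol : inner ℝ (x - p) x = (‖x‖ ^ 2 + ‖x - p‖ ^ 2 - ‖p‖ ^ 2) / 2 := by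
    have h := norm_sub_sq_real x (x - p)
    rw [sub_sub_cancel] at h
    rw [real_inner_comm]
    linarith
  have hcross : s' * inner ℝ (x - p) v ≤ s / 4 * (s ^ 2 * ‖x - p‖ ^ 2 + ‖v‖ ^ 2) := by
    have h1 : s' * inner ℝ (x - p) v ≤ -s' * |inner ℝ (x - p) v| := by
      nlinarith [neg_abs_le (inner ℝ (x - p) v)]
    have h2 := mul_le_mul_of_nonneg_right hss' (abs_nonneg (inner ℝ (x - p) v))
    have h3 := mul_le_mul_of_nonneg_left (abs_mul_inner_le hs.le (x - p) v) hs.le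
    rw [abs_mul, abs_of_pos hs] at h3
    linarith
  have hX : s * s' * ‖x‖ ^ 2 ≤ 0 :=
    mul_nonpos_of_nonpos_of_nonneg (mul_nonpos_of_nonneg_of_nonpos hs.le hs') (sq_nonneg _)
  have hY : δ ^ 2 / 2 * (s * s') * ‖x - p‖ ^ 2 ≤ 0 :=
    mul_nonpos_of_nonpos_of_nonneg (mul_nonpos_of_nonneg_of_nonpos (by positivity)
      (mul_nonpos_of_nonneg_of_nonpos hs.le hs')) (sq_nonneg _)
  have hg1 := mul_le_mul_of_nonneg_left hgap (by positivity : 0 ≤ δ / 2 * s)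
  have hc1 := mul_le_mul_of_nonneg_left hcross (by positivity : 0 ≤ δ / 2)
  rw [hpol]
  linarith

end

/-- If `E' ≤ -μ s E + K s³` with `s` decaying slowly, then `E = O(s²)`. -/
theorem exists_le_mul_sq_of_deriv_le {E E' s s' : ℝ → ℝ} {T μ K : ℝ} (hμ : 0 < μ)
    (hE : ∀ t, T ≤ t → HasDerivAt E (E' t) t) (hs : ∀ t, T ≤ t → HasDerivAt s (s' t) t)
    (hpos : ∀ t, T ≤ t → 0 < s t) (hslow : ∀ t, T ≤ t → -s' t ≤ μ / 4 * s t ^ 2)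
    (hdec : ∀ t, T ≤ t → E' t ≤ -μ * s t * E t + K * s t ^ 3) :
    ∃ M > 0, ∀ t, T ≤ t → E t ≤ M * s t ^ 2 := by
  set M := max (max 1 (2 * K / μ + 1)) (E T / s T ^ 2)
  have hM1 : 1 ≤ M := (le_max_left _ _).trans (le_max_left _ _)
  have hMK : 2 * K / μ + 1 ≤ M := (le_max_right _ _).trans (le_max_left _ _)
  have hMT : E T / s T ^ 2 ≤ M := le_max_right _ _
  have hKM : 2 * K < μ * M := by
    have h : 2 * K / μ < M := by linarith
    rw [div_lt_iff₀ hμ] at h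
    linarith
  refine ⟨M, by linarith, fun t ht => ?_⟩
  have hB : ∀ τ, T ≤ τ → HasDerivAt (fun u => M * s u ^ 2) (M * (2 * s τ * s' τ)) τ := by
    intro τ hτ
    refine (((hs τ hτ).fun_pow 2).const_mul M).congr_deriv ?_
    push_cast
    ring
  refine image_le_of_deriv_right_lt_deriv_boundary' (f := E) (f' := E') (a := T) (b := t)
    (B := fun u => M * s u ^ 2) (B' := fun u => M * (2 * s u * s' u))
    (fun τ hτ => (hE τ hτ.1).continuousAt.continuousWithinAt)
    (fun τ hτ => (hE τ hτ.1).hasDerivWithinAt) ?_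
    (fun τ hτ => (hB τ hτ.1).continuousAt.continuousWithinAt)
    (fun τ hτ => (hB τ hτ.1).hasDerivWithinAt) ?_ ⟨ht, le_rfl⟩
  · exact (div_le_iff₀ (pow_pos (hpos T le_rfl) 2)).1 hMT
  · intro τ hτ heq
    have hsτ := hpos τ hτ.1
    have h1 := hdec τ hτ.1
    rw [heq] at h1
    have h2 := mul_le_mul_of_nonneg_left (hslow τ hτ.1) (by positivity : 0 ≤ 2 * M * s τ)
    have h3 := mul_lt_mul_of_pos_right hKM (pow_pos hsτ 3)
    linarith

theorem Real.eventually_rpow_decay_slow {q η : ℝ} (hq : q < 1) (hη : 0 < η) :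
    ∀ᶠ t : ℝ in atTop, q * t ^ (-q - 1) ≤ η * (t ^ (-q)) ^ 2 := by
  have h := (tendsto_rpow_neg_atTop (sub_pos.2 hq)).eventually_le_const hη
  filter_upwards [h, eventually_gt_atTop 0] with t ht ht0
  have h1 : t ^ (-q - 1) = t ^ (-(1 - q)) * (t ^ (-q)) ^ 2 := by
    rw [← Real.rpow_mul_natCast ht0.le, ← Real.rpow_add ht0]
    congr 1
    push_cast
    ring
  have h2 : 0 ≤ t ^ (-q - 1) := by positivity
  calc q * t ^ (-q - 1) ≤ t ^ (-q - 1) := mul_le_of_le_one_left h2 hq.le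
    _ ≤ η * (t ^ (-q)) ^ 2 := by rw [h1]; gcongr

/-- `O(1/t^{3r/2-1})` convergence of values for the system
`ẍ + (δ/t^{r/2}) ẋ + ∇f(x) + (1/t^r) x = 0` with `2/3 < r < 2` (Theorem 2.5). -/
theorem trigs_subcritical_value_rate
    {H : Type*} [NormedAddCommGroup H] [InnerProductSpace ℝ H] [CompleteSpace H]
    (f : H → ℝ) (f' : H → H)
    (hconv : ConvexOn ℝ Set.univ f)
    (hgrad : ∀ y, HasGradientAt f (f' y) y)
    (hlip : ∀ s : Set H, Bornology.IsBounded s → ∃ L : NNReal, LipschitzOnWith L f' s)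
    (xbar : H) (hmin : ∀ y, f xbar ≤ f y)
    (r δ t₀ : ℝ) (hr1 : 2 / 3 < r) (hr2 : r < 2) (hδ : 0 < δ) (ht₀ : 0 < t₀)
    (x x' x'' : ℝ → H)
    (hx1 : ∀ t, t₀ ≤ t → HasDerivAt x (x' t) t)
    (hx2 : ∀ t, t₀ ≤ t → HasDerivAt x' (x'' t) t)
    (hode : ∀ t, t₀ ≤ t →
      x'' t + (δ / t ^ (r / 2)) • x' t + f' (x t) + (1 / t ^ r) • x t = 0) :
    ∃ C > 0, ∃ T, t₀ ≤ T ∧ ∀ t, T ≤ t →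
      f (x t) - f xbar ≤ C * t ^ (-(3 * r / 2 - 1)) := by
  set μ := δ / (2 * (1 + δ + δ ^ 2)) with hμdef
  have hμ : 0 < μ := by positivity
  have hq : r / 2 < 1 := by linarith
  obtain ⟨T₁, hT₁⟩ := eventually_atTop.1
    ((Real.eventually_rpow_decay_slow hq (by positivity : 0 < μ / 4)).and
      (Real.eventually_rpow_decay_slow hq (by positivity : (0 : ℝ) < 1 / 2)))
  set T := max (max t₀ 1) T₁
  have hTt₀ : t₀ ≤ T := (le_max_left _ _).trans (le_max_left _ _)
  have hT1 : 1 ≤ T := (le_max_right _ _).trans (le_max_left _ _)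
  have hpos : ∀ t, T ≤ t → 0 < t := fun t ht => by linarith
  have hs : ∀ t, T ≤ t →
      HasDerivAt (fun τ : ℝ => τ ^ (-(r / 2))) (-(r / 2) * t ^ (-(r / 2) - 1)) t :=
    fun t ht => Real.hasDerivAt_rpow_const (Or.inl (hpos t ht).ne')
  have hsq : ∀ t, T ≤ t → (t ^ (-(r / 2))) ^ 2 = t ^ (-r) := fun t ht => by
    rw [← Real.rpow_mul_natCast (hpos t ht).le]
    congr 1
    push_cast
    ring
  have hode' : ∀ t, T ≤ t → x'' t + (δ * t ^ (-(r / 2))) • x' t + f' (x t)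
      + ((t ^ (-(r / 2))) ^ 2) • x t = 0 := fun t ht => by
    have h := hode t (hTt₀.trans ht)
    rwa [div_eq_mul_inv, one_div, ← Real.rpow_neg (hpos t ht).le,
      ← Real.rpow_neg (hpos t ht).le, ← hsq t ht] at h
  obtain ⟨M, hM, hbound⟩ := exists_le_mul_sq_of_deriv_le (K := δ / 4 * ‖xbar‖ ^ 2) hμ
    (fun t ht => hasDerivAt_tikhonovEnergy (p := xbar) (hgrad (x t)) (hs t ht)
      (hx1 t (hTt₀.trans ht)) (hx2 t (hTt₀.trans ht)) (hode' t ht))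
    hs (fun t ht => Real.rpow_pos_of_pos (hpos t ht) _)
    (fun t ht => by
      have h := (hT₁ t ((le_max_right _ _).trans ht)).1
      linarith)
    (fun t ht => by
      have ht0 := hpos t ht
      have h := (hT₁ t ((le_max_right _ _).trans ht)).2
      have h2 : 0 ≤ r / 2 * t ^ (-(r / 2) - 1) := by positivity
      refine (tikhonovEnergy_deriv_le hconv (hgrad (x t)) hmin hδ
        (Real.rpow_pos_of_pos ht0 _) (by linarith) (by linarith)).trans_eq ?_
      rw [← hμdef]
      ring)
  refine ⟨M, hM, T, hTt₀, fun t ht => ?_⟩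
  calc f (x t) - f xbar ≤ M * (t ^ (-(r / 2))) ^ 2 :=
        (le_tikhonovEnergy _ _ _ _ _ _).trans (hbound t ht)
    _ = M * t ^ (-r) := by rw [hsq t ht]
    _ ≤ M * t ^ (-(3 * r / 2 - 1)) := mul_le_mul_of_nonneg_left
        (Real.rpow_le_rpow_of_exponent_le (hT1.trans ht) (by linarith)) hM.le
end

section
/- Assume hypotheses (H1)–(H3), let δ > 0, and suppose: ε(·) satisfies condition (CD)_K for some admissible K; t ↦ ε(t)^{3/2} is integrable on (t₀, ∞); and 1/(√ε(t) · exp(∫_{t₀}^t (δ − K)√ε(s) ds)) → 0 as t → ∞. Let x : [t₀, ∞) → H be a twice differentiable solution of ẍ(t) + δ√ε(t) ẋ(t) + ∇f(x(t)) + ε(t) x(t) = 0 on [t₀, ∞). Then liminf_{t → ∞} ‖x(t) − x*‖ = 0. Moreover, if there exists T ≥ t₀ such that either ‖x(t)‖ < ‖x*‖ for all t ≥ T, or ‖x(t)‖ ≥ ‖x*‖ for all t ≥ T, then x(t) converges strongly to x* as t → ∞. -/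
open Filter Set MeasureTheory intervalIntegral

lemma ConvexOn.add_inner_gradient_le {H : Type*} [NormedAddCommGroup H] [InnerProductSpace ℝ H]
    [CompleteSpace H] {f : H → ℝ} {g u : H} (hconv : ConvexOn ℝ Set.univ f)
    (hg : HasGradientAt f g u) (v : H) : f u + inner ℝ g (v - u) ≤ f v := by
  have h1 : ConvexOn ℝ Set.univ (fun t : ℝ => f (AffineMap.lineMap u v t)) :=
    hconv.comp_affineMap (AffineMap.lineMap u v)
  have h2 : HasDerivAt (fun t : ℝ => f (AffineMap.lineMap u v t)) (inner ℝ g (v - u)) 0 := by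
    have hg' := hg.hasFDerivAt
    rw [← AffineMap.lineMap_apply_zero (k := ℝ) u v] at hg'
    have h := hg'.comp_hasDerivAt (0 : ℝ) AffineMap.hasDerivAt_lineMap
    rwa [InnerProductSpace.toDual_apply_apply] at h
  have h3 := h1.le_slope_of_hasDerivAt (mem_univ 0) (mem_univ 1) one_pos h2
  simp [slope_def_field] at h3
  linarith

/-- Minimum norm well-posedness: approximate minimizers of `f` whose norm does not asymptotically
exceed that of the minimum norm solution are close to it. -/
lemma exists_pos_dist_minNorm_lt {H : Type*} [NormedAddCommGroup H] [InnerProductSpace ℝ H]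
    [CompleteSpace H] {f : H → ℝ} (hconv : ConvexOn ℝ Set.univ f) (hcont : Continuous f)
    {xs : H} (hmin : ∀ y, f xs ≤ f y) (hnorm : ∀ y, (∀ z, f y ≤ f z) → ‖xs‖ ≤ ‖y‖)
    {e : ℝ} (he : 0 < e) :
    ∃ η > 0, ∀ y, f y ≤ f xs + η → ‖y‖ ^ 2 ≤ ‖xs‖ ^ 2 + η → ‖y - xs‖ < e := by
  have hproj (c : ℝ) (hc : 0 ≤ c) : ∃ p, f p ≤ f xs + c ∧
      ∀ w, f w ≤ f xs + c → ‖w - p‖ ^ 2 ≤ ‖w‖ ^ 2 - ‖p‖ ^ 2 := by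
    have hC : Convex ℝ {y | f y ≤ f xs + c} := by simpa using hconv.convex_le (f xs + c)
    have hcl : IsClosed {y | f y ≤ f xs + c} := isClosed_le hcont continuous_const
    obtain ⟨p, hp, hpe⟩ := exists_norm_eq_iInf_of_complete_convex
      (K := {y | f y ≤ f xs + c}) ⟨xs, by simpa using hc⟩ hcl.isComplete hC 0
    rw [norm_eq_iInf_iff_real_inner_le_zero hC hp] at hpe
    refine ⟨p, hp, fun w hw => ?_⟩
    have h := hpe w hw
    rw [zero_sub, inner_neg_left, inner_sub_right, real_inner_self_eq_norm_sq] at h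
    rw [norm_sub_sq_real, real_inner_comm]
    linarith
  choose p hpf hp using fun n : ℕ => hproj (1 / ((n : ℝ) + 1)) (by positivity)
  have hmono : ∀ n m : ℕ, n ≤ m → ‖p m - p n‖ ^ 2 ≤ ‖p m‖ ^ 2 - ‖p n‖ ^ 2 := fun n m hnm =>
    hp n _ ((hpf m).trans (by gcongr))
  have hxs : ∀ n : ℕ, ‖xs - p n‖ ^ 2 ≤ ‖xs‖ ^ 2 - ‖p n‖ ^ 2 := fun n =>
    hp n _ (by have : (0 : ℝ) ≤ 1 / ((n : ℝ) + 1) := by positivity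
               linarith)
  have hm : Monotone (fun n => ‖p n‖ ^ 2) := fun n m hnm => by
    have := hmono n m hnm
    have := sq_nonneg ‖p m - p n‖
    simp only
    linarith
  have hb : BddAbove (range fun n => ‖p n‖ ^ 2) := ⟨‖xs‖ ^ 2, by
    rintro _ ⟨n, rfl⟩
    have := hxs n
    have := sq_nonneg ‖xs - p n‖
    simp only
    linarith⟩
  have hL := tendsto_atTop_ciSup hm hb
  set L := ⨆ n, ‖p n‖ ^ 2
  have hcauchy : CauchySeq p := by
    refine cauchySeq_of_le_tendsto_0' (fun n => √(L - ‖p n‖ ^ 2)) (fun n m hnm => ?_) ?_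
    · rw [dist_comm, dist_eq_norm]
      apply Real.le_sqrt_of_sq_le
      have := hmono n m hnm
      have : ‖p m‖ ^ 2 ≤ L := le_ciSup hb m
      linarith
    · have := (tendsto_const_nhds (x := L)).sub hL
      simpa using this.sqrt
  obtain ⟨q, hq⟩ := cauchySeq_tendsto_of_complete hcauchy
  have hqL : ‖q‖ ^ 2 = L := tendsto_nhds_unique (hq.norm.pow 2) hL
  have hfq : f q ≤ f xs := by
    refine le_of_tendsto_of_tendsto' ((hcont.tendsto q).comp hq) (b := atTop) ?_ hpf
    simpa using (tendsto_const_nhds (x := f xs)).add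
      (tendsto_one_div_add_atTop_nhds_zero_nat (𝕜 := ℝ))
  have hqn : ‖xs‖ ^ 2 ≤ ‖q‖ ^ 2 := by
    have := hnorm q fun z => hfq.trans (hmin z)
    gcongr
  have hlt : ∀ᶠ n in atTop, ‖xs‖ ^ 2 - e ^ 2 / 8 < ‖p n‖ ^ 2 :=
    hL.eventually_const_lt (by have := pow_pos he 2; linarith)
  obtain ⟨n, hn⟩ := hlt.exists
  refine ⟨min (1 / ((n : ℝ) + 1)) (e ^ 2 / 8), by positivity, fun y hy1 hy2 => ?_⟩
  have h1 := hp n y (hy1.trans (by gcongr; exact min_le_left _ _))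
  have h2 := hxs n
  have h3 := hy2.trans (add_le_add_right (min_le_right _ _) _)
  have h4 : ‖y - p n‖ < e / 2 := lt_of_pow_lt_pow_left₀ 2 (by positivity) (by linarith)
  have h5 : ‖xs - p n‖ < e / 2 := lt_of_pow_lt_pow_left₀ 2 (by positivity)
    (by have := pow_pos he 2; linarith)
  have h6 := norm_sub_le (y - p n) (xs - p n)
  rw [sub_sub_sub_cancel_right] at h6
  linarith

lemma antitoneOn_Ici_of_hasDerivAt_nonpos {T : ℝ} {y y' : ℝ → ℝ}
    (hy : ∀ t, T ≤ t → HasDerivAt y (y' t) t) (hy' : ∀ t, T ≤ t → y' t ≤ 0) :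
    AntitoneOn y (Ici T) :=
  antitoneOn_of_hasDerivWithinAt_nonpos (f' := y') (convex_Ici T)
    (fun t ht => (hy t ht).continuousAt.continuousWithinAt)
    (fun t ht => (hy t (interior_subset ht)).hasDerivWithinAt)
    (fun t ht => hy' t (interior_subset ht))

/-- The energy of a trajectory `x` with velocity `v`, relative to `xs`. -/
noncomputable def trigsEnergy {H : Type*} [NormedAddCommGroup H] [InnerProductSpace ℝ H]
    (f : H → ℝ) (xs : H) (K : ℝ) (ε : ℝ → ℝ) (x v : ℝ → H) (t : ℝ) : ℝ :=
  f (x t) - f xs + ε t / 2 * (‖x t‖ ^ 2 - ‖xs‖ ^ 2) +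
    ‖(K * √(ε t)) • (x t - xs) + v t‖ ^ 2 / 2

lemma exists_hasDerivAt_trigsEnergy {H : Type*} [NormedAddCommGroup H] [InnerProductSpace ℝ H]
    [CompleteSpace H] {f : H → ℝ} {g xs a : H} {ε : ℝ → ℝ} {ε' δ K ρ t : ℝ} {x v : ℝ → H}
    (hconv : ConvexOn ℝ Set.univ f) (hg : HasGradientAt f g (x t)) (hmin : ∀ y, f xs ≤ f y)
    (hε : 0 < ε t) (hε' : HasDerivAt ε ε' t) (hx : HasDerivAt x (v t) t) (hv : HasDerivAt v a t)
    (hode : a + (δ * √(ε t)) • v t + g + ε t • x t = 0)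
    (hK : 0 ≤ K) (hKδ : 0 ≤ K ^ 2 - δ * K + 1)
    (hρ : ρ = -ε' / (2 * ε t * √(ε t))) (hρ0 : 0 ≤ ρ) (hρ1 : ρ ≤ 2 * K - δ) (hρ2 : ρ ≤ δ - K) :
    ∃ D, HasDerivAt (trigsEnergy f xs K ε x v) D t ∧
      D + √(ε t) * (ρ + (δ - K)) * trigsEnergy f xs K ε x v t ≤
        -((2 * K - δ + ρ) * √(ε t) ^ 3 / 2) * (‖x t‖ ^ 2 - ‖xs‖ ^ 2) := by
  have hs : HasDerivAt (fun t => √(ε t)) (ε' / (2 * √(ε t))) t := hε'.sqrt hε.ne'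
  have hfx : HasDerivAt (fun t => f (x t)) (inner ℝ g (v t)) t := by
    have h := hg.hasFDerivAt.comp_hasDerivAt t hx
    rwa [InnerProductSpace.toDual_apply_apply] at h
  have hz := ((hs.const_mul K).smul (hx.sub_const xs)).add hv
  refine ⟨_, ((hfx.sub_const (f xs)).add ((hε'.div_const 2).mul
    (hx.norm_sq.sub_const (‖xs‖ ^ 2)))).add (hz.norm_sq.div_const 2), ?_⟩
  have hgrad := hconv.add_inner_gradient_le hg xs
  have hw := hmin (x t)
  obtain ⟨s, hs0, hse⟩ : ∃ s, 0 < s ∧ √(ε t) = s := ⟨_, Real.sqrt_pos.2 hε, rfl⟩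
  have hεs : ε t = s ^ 2 := by rw [← hse, Real.sq_sqrt hε.le]
  have he' : ε' = - 2 * ρ * s ^ 3 := by
    rw [hρ, hse, hεs]
    field_simp
  have ha : a = -((δ * s) • v t + g + s ^ 2 • x t) := by
    rw [hse, hεs] at hode
    rw [eq_neg_iff_add_eq_zero, ← hode]
    abel
  obtain ⟨d, hd⟩ : ∃ d, x t = xs + d := ⟨x t - xs, by abel⟩
  have hsd : -2 * ρ * s ^ 3 / (2 * s) = -ρ * s ^ 2 := by field_simp
  have hgrad' : f (xs + d) - f xs ≤ inner ℝ g d := by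
    rw [hd, sub_add_cancel_left, inner_neg_right] at hgrad
    linarith
  rw [hd] at hw
  have p1 : 0 ≤ K * s * (inner ℝ g d - (f (xs + d) - f xs)) :=
    mul_nonneg (by positivity) (sub_nonneg.2 hgrad')
  have p2 : 0 ≤ (2 * K - δ - ρ) * s * (f (xs + d) - f xs) :=
    mul_nonneg (mul_nonneg (by linarith) hs0.le) (by linarith)
  have p3 : 0 ≤ ‖d‖ ^ 2 * (K ^ 2 * s ^ 3 * ρ / 2 + K * s ^ 3 / 2 * (K ^ 2 - δ * K + 1)) := by
    positivity
  have p4 : 0 ≤ ‖v t‖ ^ 2 * (s * (δ - K - ρ) / 2) :=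
    mul_nonneg (sq_nonneg _) (div_nonneg (mul_nonneg hs0.le (by linarith)) two_pos.le)
  simp only [trigsEnergy, Pi.smul_apply', Pi.add_apply, hse, he', hsd, ha]
  simp only [hεs, hd, add_sub_cancel_left, norm_add_sq_real, norm_smul, inner_add_left,
    inner_add_right, inner_smul_left, inner_smul_right, inner_neg_right, mul_pow,
    Real.norm_eq_abs, sq_abs, real_inner_self_eq_norm_sq, RCLike.conj_to_real]
  rw [real_inner_comm d (v t), real_inner_comm g (v t), real_inner_comm g d,
    real_inner_comm xs d, real_inner_comm xs (v t)]
  linarith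

/-- Strong convergence to the minimum norm solution for (TRIGS) with general `ε`
(Theorem 4.1). -/
theorem trigs_general_strong_convergence
    {H : Type*} [NormedAddCommGroup H] [InnerProductSpace ℝ H] [CompleteSpace H]
    (f : H → ℝ) (f' : H → H)
    (hconv : ConvexOn ℝ Set.univ f)
    (hgrad : ∀ y, HasGradientAt f (f' y) y)
    (hlip : ∀ s : Set H, Bornology.IsBounded s → ∃ L : NNReal, LipschitzOnWith L f' s)
    (xstar : H)
    (hxstar_min : ∀ y, f xstar ≤ f y)
    (hxstar_norm : ∀ y, (∀ z, f y ≤ f z) → ‖xstar‖ ≤ ‖y‖)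
    (t₀ : ℝ) (ε ε' : ℝ → ℝ)
    (hεpos : ∀ t, t₀ ≤ t → 0 < ε t)
    (hεderiv : ∀ t, t₀ ≤ t → HasDerivAt ε (ε' t) t)
    (hεcont : ContinuousOn ε' (Set.Ici t₀))
    (hεanti : AntitoneOn ε (Set.Ici t₀))
    (hεlim : Tendsto ε atTop (nhds 0))
    (δ K t₁ : ℝ) (hδ : 0 < δ)
    (hK1 : δ ≤ 2 → δ / 2 < K ∧ K < δ)
    (hK2 : 2 < δ → (δ + Real.sqrt (δ ^ 2 - 4)) / 2 < K ∧ K < δ)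
    (ht₁ : t₀ ≤ t₁)
    (hCD : ∀ t, t₁ ≤ t →
      (-ε' t) / (2 * ε t * Real.sqrt (ε t)) ≤ min (2 * K - δ) (δ - K))
    (hint : IntegrableOn (fun t => (ε t) ^ ((3 : ℝ) / 2)) (Set.Ioi t₀))
    (hlimexp : Tendsto (fun t =>
        1 / (Real.sqrt (ε t) *
          Real.exp (∫ s in t₀..t, (δ - K) * Real.sqrt (ε s)))) atTop (nhds 0))
    (x x' x'' : ℝ → H)
    (hx1 : ∀ t, t₀ ≤ t → HasDerivAt x (x' t) t)
    (hx2 : ∀ t, t₀ ≤ t → HasDerivAt x' (x'' t) t)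
    (hode : ∀ t, t₀ ≤ t →
      x'' t + (δ * Real.sqrt (ε t)) • x' t + f' (x t) + ε t • x t = 0) :
    Filter.liminf (fun t => ‖x t - xstar‖) atTop = 0 ∧
    ((∃ T, t₀ ≤ T ∧
        ((∀ t, T ≤ t → ‖x t‖ < ‖xstar‖) ∨ (∀ t, T ≤ t → ‖xstar‖ ≤ ‖x t‖))) →
      Tendsto x atTop (nhds xstar)) := by
  obtain ⟨hKδ2, hKδ⟩ : δ / 2 < K ∧ K < δ := by
    rcases le_or_gt δ 2 with h | h
    · exact hK1 h
    · exact ⟨by linarith [(hK2 h).1, Real.sqrt_nonneg (δ ^ 2 - 4)], (hK2 h).2⟩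
  have hquad : 0 ≤ K ^ 2 - δ * K + 1 := by
    rcases le_or_gt δ 2 with h | h
    · nlinarith [sq_nonneg (K - δ / 2)]
    · have h1 := (hK2 h).1
      have h2 := Real.sqrt_nonneg (δ ^ 2 - 4)
      have h3 := Real.sq_sqrt (show 0 ≤ δ ^ 2 - 4 by nlinarith)
      nlinarith [pow_le_pow_left₀ h2 (show √(δ ^ 2 - 4) ≤ 2 * K - δ by linarith) 2]
  have hfcont : Continuous f :=
    continuous_iff_continuousAt.2 fun y => (hgrad y).hasFDerivAt.continuousAt
  have hε'0 : ∀ t, t₀ ≤ t → ε' t ≤ 0 := fun t ht => by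
    rw [← (hεderiv t ht).hasDerivWithinAt.derivWithin (uniqueDiffOn_Ici t₀ t ht)]
    exact hεanti.derivWithin_nonpos
  set I : ℝ → ℝ := fun t => ∫ s in t₀..t, (δ - K) * √(ε s)
  set E : ℝ → ℝ := trigsEnergy f xstar K ε x x' with hE
  set ρ : ℝ → ℝ := fun t => -ε' t / (2 * ε t * √(ε t)) with hρ
  have hlimexpI : Tendsto (fun t => 1 / (√(ε t) * Real.exp (I t))) atTop (nhds 0) := hlimexp
  have hsc : ContinuousOn (fun s => (δ - K) * √(ε s)) (Ici t₀) := fun t ht =>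
    (continuousAt_const.mul (hεderiv t ht).continuousAt.sqrt).continuousWithinAt
  have hI' : ∀ t, t₁ + 1 ≤ t → HasDerivAt I ((δ - K) * √(ε t)) t := fun t ht => by
    have h0 : t₀ < t := by linarith
    refine integral_hasDerivAt_right ?_ ?_ (hsc.continuousAt (Ici_mem_nhds h0))
    · refine (hsc.mono ?_).intervalIntegrable
      rw [uIcc_of_le h0.le]
      exact Icc_subset_Ici_self
    · exact (hsc.mono Ioi_subset_Ici_self).stronglyMeasurableAtFilter isOpen_Ioi t h0
  have hs0 : ∀ t, t₁ + 1 ≤ t → 0 < √(ε t) := fun t ht =>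
    Real.sqrt_pos.2 (hεpos t (by linarith))
  have hρ0 : ∀ t, t₁ + 1 ≤ t → 0 ≤ ρ t := fun t ht => by
    have h1 := hε'0 t (by linarith)
    have h2 := hεpos t (by linarith)
    exact div_nonneg (by linarith) (by positivity)
  have hρ1 : ∀ t, t₁ + 1 ≤ t → ρ t ≤ 2 * K - δ := fun t ht =>
    (hCD t (by linarith)).trans (min_le_left _ _)
  have hρ2 : ∀ t, t₁ + 1 ≤ t → ρ t ≤ δ - K := fun t ht =>
    (hCD t (by linarith)).trans (min_le_right _ _)
  choose! D hDt hDρ using fun t (ht : t₁ + 1 ≤ t) =>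
    have h0 : t₀ ≤ t := by linarith
    exists_hasDerivAt_trigsEnergy hconv (hgrad (x t)) hxstar_min (hεpos t h0) (hεderiv t h0)
      (hx1 t h0) (hx2 t h0) (hode t h0) (by linarith) hquad rfl (hρ0 t ht) (hρ1 t ht) (hρ2 t ht)
  have hD : ∀ t, t₁ + 1 ≤ t → HasDerivAt E (D t) t := hDt
  have hDle : ∀ t, t₁ + 1 ≤ t → D t + √(ε t) * (ρ t + (δ - K)) * E t ≤
      -((2 * K - δ + ρ t) * √(ε t) ^ 3 / 2) * (‖x t‖ ^ 2 - ‖xstar‖ ^ 2) := hDρ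
  have he' : ∀ t, t₁ + 1 ≤ t → ε' t = -2 * ρ t * √(ε t) ^ 3 := fun t ht => by
    have h0 := hεpos t (by linarith)
    have hss := Real.sq_sqrt h0.le
    simp only [hρ]
    field_simp
    rw [hss]
  have hEF : ∀ t, t₀ ≤ t → f (x t) - f xstar ≤ E t + ε t / 2 * ‖xstar‖ ^ 2 := fun t ht => by
    have := (hεpos t ht).le
    have h2 : 0 ≤ ε t / 2 * ‖x t‖ ^ 2 + ‖(K * √(ε t)) • (x t - xstar) + x' t‖ ^ 2 / 2 := by
      positivity
    simp only [hE, trigsEnergy]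
    linarith
  have hexp : Tendsto (fun t => Real.exp (-I t)) atTop (nhds 0) := by
    have h := hεlim.sqrt.mul hlimexpI
    rw [mul_zero] at h
    refine h.congr' ?_
    filter_upwards [eventually_ge_atTop (t₁ + 1)] with t ht
    have := (hs0 t ht).ne'
    rw [Real.exp_neg]
    field_simp
  have hf : ∀ η > 0, ∀ᶠ t in atTop, f (x t) ≤ f xstar + η := by
    intro η hη
    set C : ℝ := ‖xstar‖ ^ 2 * K / 2 with hC
    have hsmall : ∀ᶠ t in atTop, C * ε t < (δ - K) * (η / 2) := by
      have h := hεlim.const_mul C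
      rw [mul_zero] at h
      exact h.eventually_lt_const (mul_pos (by linarith) (by positivity))
    obtain ⟨T, hT⟩ := eventually_atTop.1 (hsmall.and (eventually_ge_atTop (t₁ + 1)))
    have hanti := antitoneOn_Ici_of_hasDerivAt_nonpos
      (y := fun t => Real.exp (I t) * (E t + ε t / 2 * ‖xstar‖ ^ 2 - η / 2))
      (fun t ht => (hI' t (hT t ht).2).exp.mul (((hD t (hT t ht).2).add
        (((hεderiv t (by linarith [(hT t ht).2])).div_const 2).mul_const _)).sub_const _))
      (fun t ht => by
        obtain ⟨h1, h2⟩ := hT t ht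
        have h0 : t₀ ≤ t := by linarith
        have h3 := hDle t h2
        have h4 := hEF t h0
        have h5 := hxstar_min (x t)
        have hs := hs0 t h2
        have hr0 := hρ0 t h2
        have he := he' t h2
        obtain ⟨s, hse⟩ : ∃ s, √(ε t) = s := ⟨_, rfl⟩
        have hεs : ε t = s ^ 2 := by rw [← hse, Real.sq_sqrt (hεpos t h0).le]
        rw [hse] at hs he h3
        rw [hεs] at h1 h4
        have q1 : 0 ≤ (2 * K - δ + ρ t) * s ^ 3 / 2 * ‖x t‖ ^ 2 := by
          have : 0 ≤ 2 * K - δ := by linarith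
          positivity
        have q2 : 0 ≤ s * ρ t * (E t + s ^ 2 / 2 * ‖xstar‖ ^ 2) :=
          mul_nonneg (by positivity) (by linarith)
        have q3 : 0 ≤ s * ((δ - K) * (η / 2) - C * s ^ 2) :=
          mul_nonneg hs.le (by linarith)
        rw [hC] at q3
        have key : (δ - K) * s * (E t + s ^ 2 / 2 * ‖xstar‖ ^ 2 - η / 2) +
            (D t + ε' t / 2 * ‖xstar‖ ^ 2) ≤ 0 := by
          rw [he]
          linarith
        have := mul_nonpos_of_nonneg_of_nonpos (Real.exp_pos (I t)).le key
        simp only [Pi.add_apply, hse]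
        simp only [hεs]
        linarith)
    have hsm : ∀ᶠ t in atTop,
        Real.exp (I T) * (E T + ε T / 2 * ‖xstar‖ ^ 2 - η / 2) * Real.exp (-I t) < η / 2 := by
      have h := hexp.const_mul (Real.exp (I T) * (E T + ε T / 2 * ‖xstar‖ ^ 2 - η / 2))
      rw [mul_zero] at h
      exact h.eventually_lt_const (by positivity)
    filter_upwards [hsm, eventually_ge_atTop T] with t ht1 ht2
    have h1 := mul_le_mul_of_nonneg_right (hanti self_mem_Ici ht2 ht2) (Real.exp_pos (-I t)).le
    have h2 : Real.exp (I t) * Real.exp (-I t) = 1 := by rw [← Real.exp_add]; simp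
    have h3 := hEF t (by linarith [(hT t ht2).2])
    simp only at h1
    rw [mul_right_comm, h2, one_mul] at h1
    linarith
  have hout : (∀ᶠ t in atTop, ‖xstar‖ ≤ ‖x t‖) → Tendsto x atTop (nhds xstar) := by
    intro hev
    obtain ⟨T, hT⟩ := eventually_atTop.1 (hev.and (eventually_ge_atTop (t₁ + 1)))
    have hanti := antitoneOn_Ici_of_hasDerivAt_nonpos
      (y := fun t => Real.exp (I t) * E t / √(ε t))
      (fun t ht => ((hI' t (hT t ht).2).exp.mul (hD t (hT t ht).2)).div
        ((hεderiv t (by linarith [(hT t ht).2])).sqrt (hεpos t (by linarith [(hT t ht).2])).ne')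
        (hs0 t (hT t ht).2).ne')
      (fun t ht => by
        obtain ⟨h1, h2⟩ := hT t ht
        have h3 := hDle t h2
        have hs := hs0 t h2
        have hr0 := hρ0 t h2
        have hd : ε' t / (2 * √(ε t)) = -ρ t * √(ε t) ^ 2 := by
          rw [he' t h2]
          field_simp
        rw [hd]
        refine div_nonpos_of_nonpos_of_nonneg ?_ (sq_nonneg _)
        have q1 : 0 ≤ (2 * K - δ + ρ t) * √(ε t) ^ 3 / 2 * (‖x t‖ ^ 2 - ‖xstar‖ ^ 2) := by
          have h4 : 0 ≤ 2 * K - δ := by linarith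
          have h5 : 0 ≤ ‖x t‖ ^ 2 - ‖xstar‖ ^ 2 := sub_nonneg.2 (by gcongr)
          positivity
        simp only [Pi.mul_apply]
        have := mul_nonpos_of_nonneg_of_nonpos
          (mul_pos (Real.exp_pos (I t)) hs).le (h3.trans (by linarith))
        linarith)
    have hlim2 : Tendsto (fun t => 2 * (Real.exp (I T) * E T / √(ε T)) *
        (1 / (√(ε t) * Real.exp (I t)))) atTop (nhds 0) := by
      simpa using hlimexpI.const_mul (2 * (Real.exp (I T) * E T / √(ε T)))
    rw [Metric.tendsto_nhds]
    intro e he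
    obtain ⟨η, hη, hηlt⟩ := exists_pos_dist_minNorm_lt hconv hfcont hxstar_min hxstar_norm he
    filter_upwards [hf η hη, hlim2.eventually_lt_const hη, eventually_ge_atTop T]
      with t ht1 ht2 ht3
    rw [dist_eq_norm]
    refine hηlt _ ht1 ?_
    have h1 := hanti self_mem_Ici ht3 ht3
    have h0 : t₀ ≤ t := by linarith [(hT t ht3).2]
    have hs := hs0 t (hT t ht3).2
    have hεt := hεpos t h0
    have h2 : ε t / 2 * (‖x t‖ ^ 2 - ‖xstar‖ ^ 2) ≤ E t := by
      have := hxstar_min (x t)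
      have := sq_nonneg ‖(K * √(ε t)) • (x t - xstar) + x' t‖
      simp only [hE, trigsEnergy]
      linarith
    have h3 : Real.exp (I t) * E t / √(ε t) * (2 * (1 / (√(ε t) * Real.exp (I t)))) =
        2 * E t / ε t := by
      have hss := Real.mul_self_sqrt hεt.le
      have := Real.exp_pos (I t)
      nth_rewrite 3 [← hss]
      field_simp
    have h4 := mul_le_mul_of_nonneg_right h1
      (show 0 ≤ 2 * (1 / (√(ε t) * Real.exp (I t))) by positivity)
    simp only at h4
    rw [h3] at h4
    have h5 : ‖x t‖ ^ 2 - ‖xstar‖ ^ 2 ≤ 2 * E t / ε t := by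
      rw [le_div_iff₀ hεt]
      linarith
    linarith
  have hin : ∀ e > 0, ∀ᶠ t in atTop, ‖x t‖ < ‖xstar‖ → ‖x t - xstar‖ < e := by
    intro e he
    obtain ⟨η, hη, hηlt⟩ := exists_pos_dist_minNorm_lt hconv hfcont hxstar_min hxstar_norm he
    filter_upwards [hf η hη] with t ht hlt
    refine hηlt _ ht ?_
    have : ‖x t‖ ^ 2 ≤ ‖xstar‖ ^ 2 := by gcongr
    linarith
  refine ⟨?_, ?_⟩
  · have hfreq : ∀ e > 0, ∃ᶠ t in atTop, ‖x t - xstar‖ < e := by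
      intro e he
      by_cases h : ∀ᶠ t in atTop, ‖xstar‖ ≤ ‖x t‖
      · refine Eventually.frequently ?_
        simpa [dist_eq_norm] using Metric.tendsto_nhds.1 (hout h) e he
      · simp only [not_eventually, not_le] at h
        exact (h.and_eventually (hin e he)).mono fun t ht => ht.2 ht.1
    rw [liminf_eq]
    refine IsGreatest.csSup_eq ⟨Eventually.of_forall fun t => norm_nonneg _, fun b hb => ?_⟩
    refine le_of_forall_pos_lt_add fun e he => ?_
    obtain ⟨t, ht1, ht2⟩ := ((hfreq e he).and_eventually hb).exists
    linarith
  · rintro ⟨T, -, hT | hT⟩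
    · rw [Metric.tendsto_nhds]
      intro e he
      filter_upwards [hin e he, eventually_ge_atTop T] with t ht1 ht2
      rw [dist_eq_norm]
      exact ht1 (hT t ht2)
    · exact hout (eventually_atTop.2 ⟨T, hT⟩)
end
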